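/- arXiv:1809.02799 — 4 statements merged into one kernel-verified Lean document; each statement's English description precedes it below -/
import Mathlib

section
/- Let α ≥ 5 be an integer and let G be a finite simple graph such that every subgraph G' of G satisfies at least one of: (i) G' has a vertex of degree at most 1; (ii) G' contains an edge uv with d_{G'}(u) + d_{G'}(v) ≤ α; (iii) G' contains a 2-alternating cycle. Then the edge set of G can be partitioned into three pairwise disjoint sets inducing spanning subgraphs F₁, F₂, H such that F₁ and F₂ are forests with d_{F_i}(v) ≤ max{2, ⌈(d_G(v) − α + 6)/2⌉} for every vertex v and each i ∈ {1,2}, while H has maximum degree at most α − 5. -/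
/-- A 2-alternating cycle in a subgraph `G'` of `G`: a cycle `v₀v₁⋯v₂ₙ₋₁v₀` of even
length `2n ≥ 4` (vertices pairwise distinct) all of whose even-indexed vertices have
degree 2 in `G'`. -/
def SubgraphHasTwoAlternatingCycle {V : Type*} {G : SimpleGraph V} (G' : G.Subgraph) : Prop :=
  ∃ (n : ℕ) (f : ℕ → V), 2 ≤ n ∧
    (∀ i < 2 * n, ∀ j < 2 * n, f i = f j → i = j) ∧
    (∀ i < 2 * n, G'.Adj (f i) (f ((i + 1) % (2 * n)))) ∧
    (∀ i < 2 * n, i % 2 = 0 → (G'.neighborSet (f i)).ncard = 2)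

/-- `F₁`, `F₂`, `H` form an edge partition of `G` into three spanning subgraphs:
their edge sets are pairwise disjoint and their union is the edge set of `G`. -/
def EdgePartition3 {V : Type*} (G F₁ F₂ H : SimpleGraph V) : Prop :=
  F₁.edgeSet ∪ F₂.edgeSet ∪ H.edgeSet = G.edgeSet ∧
  Disjoint F₁.edgeSet F₂.edgeSet ∧
  Disjoint F₁.edgeSet H.edgeSet ∧
  Disjoint F₂.edgeSet H.edgeSet

namespace SimpleGraph

variable {V : Type*}

theorem ncard_neighborSet_sup [Finite V] {F M : SimpleGraph V} (h : Disjoint F M) (v : V) :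
    ((F ⊔ M).neighborSet v).ncard = (F.neighborSet v).ncard + (M.neighborSet v).ncard := by
  rw [neighborSet_sup]
  exact Set.ncard_union_eq (disjoint_neighborSet.mpr h v) (Set.toFinite _) (Set.toFinite _)

/-- Adding edges to an acyclic graph keeps it acyclic when every new edge has an endpoint that is
a leaf of the resulting graph. -/
theorem IsAcyclic.of_forall_leaf [Finite V] {F F' : SimpleGraph V} (hF : F.IsAcyclic)
    (h : ∀ x y, F'.Adj x y → ¬ F.Adj x y →
      (F'.neighborSet x).ncard ≤ 1 ∨ (F'.neighborSet y).ncard ≤ 1) : F'.IsAcyclic := by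
  intro v c hc
  have two_le : ∀ x ∈ c.support, 2 ≤ (F'.neighborSet x).ncard := fun x hx ↦
    (hc.ncard_neighborSet_toSubgraph_eq_two hx).ge.trans
      (Set.ncard_le_ncard (c.toSubgraph.neighborSet_subset x) (Set.toFinite _))
  have mem : ∀ e ∈ c.edges, e ∈ F.edgeSet := by
    intro e
    induction e with
    | h x y =>
      intro he
      by_contra hn
      have hx := two_le x (c.fst_mem_support_of_mem_edges he)
      have hy := two_le y (c.snd_mem_support_of_mem_edges he)
      rcases h x y (c.adj_of_mem_edges he) hn with h | h <;> omega
  exact hF _ (hc.transfer mem)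

theorem ncard_neighborSet_edge_left {u v : V} (h : u ≠ v) :
    ((edge u v).neighborSet u).ncard = 1 := by
  rw [Set.ncard_eq_one]
  refine ⟨v, ?_⟩
  ext x
  simp only [mem_neighborSet, edge_adj, Set.mem_singleton_iff]
  grind

theorem ncard_neighborSet_edge_right {u v : V} (h : u ≠ v) :
    ((edge u v).neighborSet v).ncard = 1 := by
  rw [edge_comm]
  exact ncard_neighborSet_edge_left h.symm

theorem ncard_neighborSet_edge_of_ne {u v w : V} (hu : w ≠ u) (hv : w ≠ v) :
    ((edge u v).neighborSet w).ncard = 0 := by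
  have : (edge u v).neighborSet w = ∅ := by
    ext x
    simp only [mem_neighborSet, edge_adj, Set.mem_empty_iff_false]
    grind
  simp [this]

/-- `K` is partitioned into two forests `F₁`, `F₂`, whose degrees at each vertex `v` are at most
`max {2, ⌈(d_K(v) - α + 6)/2⌉}`, and a graph `H` of maximum degree at most `α - 5`. -/
structure IsForestDecomposition (α : ℕ) (K F₁ F₂ H : SimpleGraph V) : Prop where
  sup_eq : F₁ ⊔ F₂ ⊔ H = K
  disjoint : Disjoint F₁ F₂
  disjoint_left : Disjoint F₁ H
  disjoint_right : Disjoint F₂ H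
  acyclic_left : F₁.IsAcyclic
  acyclic_right : F₂.IsAcyclic
  degree_left : ∀ v, (F₁.neighborSet v).ncard ≤ 2 ∨
    2 * (F₁.neighborSet v).ncard + α ≤ (K.neighborSet v).ncard + 7
  degree_right : ∀ v, (F₂.neighborSet v).ncard ≤ 2 ∨
    2 * (F₂.neighborSet v).ncard + α ≤ (K.neighborSet v).ncard + 7
  degree_rest : ∀ v, (H.neighborSet v).ncard + 5 ≤ α

namespace IsForestDecomposition

variable {α : ℕ} {K F₁ F₂ H : SimpleGraph V}

theorem symm (h : IsForestDecomposition α K F₁ F₂ H) : IsForestDecomposition α K F₂ F₁ H where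
  sup_eq := by rw [sup_comm F₂, h.sup_eq]
  disjoint := h.disjoint.symm
  disjoint_left := h.disjoint_right
  disjoint_right := h.disjoint_left
  acyclic_left := h.acyclic_right
  acyclic_right := h.acyclic_left
  degree_left := h.degree_right
  degree_right := h.degree_left
  degree_rest := h.degree_rest

theorem ncard_eq [Finite V] (h : IsForestDecomposition α K F₁ F₂ H) (v : V) :
    (K.neighborSet v).ncard =
      (F₁.neighborSet v).ncard + (F₂.neighborSet v).ncard + (H.neighborSet v).ncard := by
  rw [← h.sup_eq, ncard_neighborSet_sup (Disjoint.sup_left h.disjoint_left h.disjoint_right),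
    ncard_neighborSet_sup h.disjoint]

theorem disjoint_of_sdiff {M : SimpleGraph V} (h : IsForestDecomposition α (K \ M) F₁ F₂ H) :
    Disjoint F₁ M ∧ Disjoint F₂ M ∧ Disjoint H M := by
  have hM : Disjoint (F₁ ⊔ F₂ ⊔ H) M := h.sup_eq ▸ disjoint_sdiff_self_left
  rw [disjoint_sup_left, disjoint_sup_left] at hM
  exact ⟨hM.1.1, hM.1.2, hM.2⟩

theorem ncard_sdiff_add [Finite V] {M : SimpleGraph V} (hM : M ≤ K) (v : V) :
    (K.neighborSet v).ncard = ((K \ M).neighborSet v).ncard + (M.neighborSet v).ncard := by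
  rw [← ncard_neighborSet_sup disjoint_sdiff_self_left, sdiff_sup_cancel hM]

theorem add_left [Finite V] {u v : V} (huv : K.Adj u v)
    (h : IsForestDecomposition α (K \ edge u v) F₁ F₂ H)
    (h0 : (F₁.neighborSet u).ncard = 0)
    (hv : (F₁.neighborSet v).ncard ≤ 1 ∨
      2 * (F₁.neighborSet v).ncard + α ≤ (K.neighborSet v).ncard + 5) :
    IsForestDecomposition α K (F₁ ⊔ edge u v) F₂ H := by
  have hle : edge u v ≤ K := by rwa [edge_le_iff, or_iff_right huv.ne]
  obtain ⟨d₁, d₂, d₃⟩ := h.disjoint_of_sdiff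
  have hK := ncard_sdiff_add hle
  have hs := ncard_neighborSet_sup d₁
  have eu := ncard_neighborSet_edge_left huv.ne
  have ev := ncard_neighborSet_edge_right huv.ne
  refine ⟨?_, ?_, ?_, h.disjoint_right, ?_, h.acyclic_right, ?_, ?_, h.degree_rest⟩
  · rw [sup_right_comm F₁, sup_right_comm (F₁ ⊔ F₂), h.sup_eq, sdiff_sup_cancel hle]
  · exact Disjoint.sup_left h.disjoint d₂.symm
  · exact Disjoint.sup_left h.disjoint_left d₃.symm
  · refine h.acyclic_left.of_forall_leaf fun x y hxy hn ↦ ?_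
    have hu : ((F₁ ⊔ edge u v).neighborSet u).ncard ≤ 1 := by rw [hs, h0, eu]
    rw [sup_adj, or_iff_right hn, edge_adj] at hxy
    rcases hxy.1 with ⟨rfl, rfl⟩ | ⟨rfl, rfl⟩
    · exact .inl hu
    · exact .inr hu
  · intro w
    have := h.degree_left w
    rw [hs w]
    by_cases hwu : w = u
    · subst hwu; omega
    by_cases hwv : w = v
    · subst hwv; omega
    have := ncard_neighborSet_edge_of_ne hwu hwv
    have := hK w
    omega
  · intro w
    have := h.degree_right w
    have := hK w
    omega

theorem add_rest [Finite V] {u v : V} (huv : K.Adj u v)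
    (h : IsForestDecomposition α (K \ edge u v) F₁ F₂ H)
    (hu : (H.neighborSet u).ncard + 6 ≤ α) (hv : (H.neighborSet v).ncard + 6 ≤ α) :
    IsForestDecomposition α K F₁ F₂ (H ⊔ edge u v) := by
  have hle : edge u v ≤ K := by rwa [edge_le_iff, or_iff_right huv.ne]
  obtain ⟨d₁, d₂, d₃⟩ := h.disjoint_of_sdiff
  have hK := ncard_sdiff_add hle
  have hs := ncard_neighborSet_sup d₃
  have eu := ncard_neighborSet_edge_left huv.ne
  have ev := ncard_neighborSet_edge_right huv.ne
  refine ⟨?_, h.disjoint, ?_, ?_, h.acyclic_left, h.acyclic_right, ?_, ?_, ?_⟩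
  · rw [← sup_assoc, h.sup_eq, sdiff_sup_cancel hle]
  · exact Disjoint.sup_right h.disjoint_left d₁
  · exact Disjoint.sup_right h.disjoint_right d₂
  · intro w
    have := h.degree_left w
    have := hK w
    omega
  · intro w
    have := h.degree_right w
    have := hK w
    omega
  · intro w
    have := h.degree_rest w
    rw [hs w]
    by_cases hwu : w = u
    · subst hwu; omega
    by_cases hwv : w = v
    · subst hwv; omega
    have := ncard_neighborSet_edge_of_ne hwu hwv
    omega

/-- A decomposition extends over a pendant edge. -/
theorem exists_of_leaf [Finite V] {u v : V} (huv : K.Adj u v)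
    (h : IsForestDecomposition α (K \ edge u v) F₁ F₂ H) (hu : (K.neighborSet u).ncard ≤ 1) :
    ∃ F₁ F₂ H, IsForestDecomposition α K F₁ F₂ H := by
  have hle : edge u v ≤ K := by rwa [edge_le_iff, or_iff_right huv.ne]
  have hKu := ncard_sdiff_add hle u
  have hKv := ncard_sdiff_add hle v
  have eu := ncard_neighborSet_edge_left huv.ne
  have ev := ncard_neighborSet_edge_right huv.ne
  have hdu := h.ncard_eq u
  have hdv := h.ncard_eq v
  have hrv := h.degree_rest v
  by_cases hH : (H.neighborSet v).ncard + 6 ≤ α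
  · exact ⟨_, _, _, h.add_rest huv (by omega) hH⟩
  rcases le_total (F₁.neighborSet v).ncard (F₂.neighborSet v).ncard with hF | hF
  · exact ⟨_, _, _, h.add_left huv (by omega) (by omega)⟩
  · exact ⟨_, _, _, h.symm.add_left huv (by omega) (by omega)⟩

/-- A decomposition extends over an edge of small degree sum. -/
theorem exists_of_light_edge [Finite V] {u v : V} (huv : K.Adj u v)
    (h : IsForestDecomposition α (K \ edge u v) F₁ F₂ H)
    (hlight : (K.neighborSet u).ncard + (K.neighborSet v).ncard ≤ α) :
    ∃ F₁ F₂ H, IsForestDecomposition α K F₁ F₂ H := by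
  have hle : edge u v ≤ K := by rwa [edge_le_iff, or_iff_right huv.ne]
  have hKu := ncard_sdiff_add hle u
  have hKv := ncard_sdiff_add hle v
  have eu := ncard_neighborSet_edge_left huv.ne
  have ev := ncard_neighborSet_edge_right huv.ne
  have hdu := h.ncard_eq u
  have hdv := h.ncard_eq v
  have hru := h.degree_rest u
  have hrv := h.degree_rest v
  have h' : IsForestDecomposition α (K \ edge v u) F₁ F₂ H := edge_comm u v ▸ h
  by_cases hH : (H.neighborSet u).ncard + 6 ≤ α ∧ (H.neighborSet v).ncard + 6 ≤ α
  · exact ⟨_, _, _, h.add_rest huv hH.1 hH.2⟩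
  by_cases h₁ : (F₁.neighborSet u).ncard = 0 ∧ (F₁.neighborSet v).ncard ≤ 1
  · exact ⟨_, _, _, h.add_left huv h₁.1 (.inl h₁.2)⟩
  by_cases h₂ : (F₁.neighborSet v).ncard = 0 ∧ (F₁.neighborSet u).ncard ≤ 1
  · exact ⟨_, _, _, h'.add_left huv.symm h₂.1 (.inl h₂.2)⟩
  by_cases h₃ : (F₂.neighborSet u).ncard = 0 ∧ (F₂.neighborSet v).ncard ≤ 1
  · exact ⟨_, _, _, h.symm.add_left huv h₃.1 (.inl h₃.2)⟩
  · exact ⟨_, _, _, h'.symm.add_left huv.symm (by omega) (.inl (by omega))⟩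

end IsForestDecomposition

/-- The graph joining each `x ∈ A` to `b x`. -/
def graphOn (A : Set V) (b : V → V) : SimpleGraph V where
  Adj x y := x ≠ y ∧ (x ∈ A ∧ b x = y ∨ y ∈ A ∧ b y = x)
  symm := ⟨fun _ _ h ↦ ⟨h.1.symm, h.2.symm⟩⟩
  loopless := ⟨fun _ h ↦ h.1 rfl⟩

section graphOn

variable {A : Set V} {b c : V → V}

theorem graphOn_le {K : SimpleGraph V} (h : ∀ x ∈ A, K.Adj x (b x)) : graphOn A b ≤ K := by
  rintro x y ⟨-, ⟨hx, rfl⟩ | ⟨hx, rfl⟩⟩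
  exacts [h _ hx, (h _ hx).symm]

theorem ncard_neighborSet_graphOn_of_mem (hb : ∀ x ∈ A, b x ∉ A) {x : V} (hx : x ∈ A) :
    ((graphOn A b).neighborSet x).ncard = 1 := by
  rw [Set.ncard_eq_one]
  refine ⟨b x, ?_⟩
  ext y
  simp only [mem_neighborSet, graphOn, Set.mem_singleton_iff]
  grind

theorem ncard_neighborSet_graphOn_of_mem_image (hb : ∀ x ∈ A, b x ∉ A) (hi : A.InjOn b) {y : V}
    (hy : y ∈ b '' A) : ((graphOn A b).neighborSet y).ncard = 1 := by
  obtain ⟨x, hx, rfl⟩ := hy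
  rw [Set.ncard_eq_one]
  refine ⟨x, ?_⟩
  ext y
  simp only [mem_neighborSet, graphOn, Set.mem_singleton_iff]
  have := hb x hx
  constructor
  · rintro ⟨-, ⟨h, -⟩ | ⟨h, h'⟩⟩
    · exact absurd h this
    · exact hi h hx h'
  · grind

theorem ncard_neighborSet_graphOn_of_notMem {x : V} (hx : x ∉ A) (hx' : x ∉ b '' A) :
    ((graphOn A b).neighborSet x).ncard = 0 := by
  have : (graphOn A b).neighborSet x = ∅ := by
    ext y
    simp only [mem_neighborSet, graphOn, Set.mem_empty_iff_false]
    grind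
  simp [this]

/-- A decomposition extends over a 2-alternating cycle, described by the set `A` of its
even-indexed vertices and the successor and predecessor functions `b`, `c` on `A`, provided its
odd-indexed vertices have large degree. -/
theorem IsForestDecomposition.add_alternating [Finite V] {α : ℕ} {K F₁ F₂ H : SimpleGraph V}
    (hb : ∀ x ∈ A, b x ∉ A) (hc : ∀ x ∈ A, c x ∉ A) (hbi : A.InjOn b) (hci : A.InjOn c)
    (hbc : ∀ x ∈ A, b x ≠ c x) (himage : b '' A = c '' A)
    (hKb : ∀ x ∈ A, K.Adj x (b x)) (hKc : ∀ x ∈ A, K.Adj x (c x))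
    (hA : ∀ x ∈ A, (K.neighborSet x).ncard = 2)
    (hheavy : ∀ y ∈ b '' A, α ≤ (K.neighborSet y).ncard + 1)
    (h : IsForestDecomposition α (K \ (graphOn A b ⊔ graphOn A c)) F₁ F₂ H) :
    IsForestDecomposition α K (F₁ ⊔ graphOn A b) (F₂ ⊔ graphOn A c) H := by
  have hle : graphOn A b ⊔ graphOn A c ≤ K := sup_le (graphOn_le hKb) (graphOn_le hKc)
  have hd : Disjoint (graphOn A b) (graphOn A c) := by
    rw [← disjoint_edgeSet, Set.disjoint_left, Sym2.forall]
    simp only [mem_edgeSet, graphOn]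
    grind
  obtain ⟨d₁, d₂, d₃⟩ := h.disjoint_of_sdiff
  rw [disjoint_sup_right] at d₁ d₂ d₃
  have hK (w : V) := IsForestDecomposition.ncard_sdiff_add hle w
  simp only [ncard_neighborSet_sup hd] at hK
  have hs₁ := ncard_neighborSet_sup d₁.1
  have hs₂ := ncard_neighborSet_sup d₂.2
  have hdeg := h.ncard_eq
  have hbA (x) (hx : x ∈ A) := ncard_neighborSet_graphOn_of_mem hb hx
  have hcA (x) (hx : x ∈ A) := ncard_neighborSet_graphOn_of_mem hc hx
  have trichotomy (w : V) :
      w ∈ A ∨ (α ≤ (K.neighborSet w).ncard + 1 ∧ ((graphOn A b).neighborSet w).ncard = 1 ∧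
        ((graphOn A c).neighborSet w).ncard = 1) ∨
      (((graphOn A b).neighborSet w).ncard = 0 ∧ ((graphOn A c).neighborSet w).ncard = 0) := by
    by_cases hw : w ∈ A
    · exact .inl hw
    by_cases hw' : w ∈ b '' A
    · exact .inr <| .inl ⟨hheavy w hw', ncard_neighborSet_graphOn_of_mem_image hb hbi hw',
        ncard_neighborSet_graphOn_of_mem_image hc hci (himage ▸ hw')⟩
    · exact .inr <| .inr ⟨ncard_neighborSet_graphOn_of_notMem hw hw',
        ncard_neighborSet_graphOn_of_notMem hw (himage ▸ hw')⟩
  have leaf₁ (x) (hx : x ∈ A) : ((F₁ ⊔ graphOn A b).neighborSet x).ncard ≤ 1 := by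
    have := hK x; have := hA x hx; have := hdeg x; have := hbA x hx; have := hcA x hx
    rw [hs₁]; omega
  have leaf₂ (x) (hx : x ∈ A) : ((F₂ ⊔ graphOn A c).neighborSet x).ncard ≤ 1 := by
    have := hK x; have := hA x hx; have := hdeg x; have := hbA x hx; have := hcA x hx
    rw [hs₂]; omega
  refine ⟨?_, ?_, ?_, ?_, ?_, ?_, ?_, ?_, h.degree_rest⟩
  · rw [sup_sup_sup_comm, sup_right_comm, h.sup_eq, sdiff_sup_cancel hle]
  · exact Disjoint.sup_left (Disjoint.sup_right h.disjoint d₁.2)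
      (Disjoint.sup_right d₂.1.symm hd)
  · exact Disjoint.sup_left h.disjoint_left d₃.1.symm
  · exact Disjoint.sup_left h.disjoint_right d₃.2.symm
  · refine h.acyclic_left.of_forall_leaf fun x y hxy hn ↦ ?_
    rw [sup_adj, or_iff_right hn] at hxy
    exact hxy.2.imp (fun h ↦ leaf₁ x h.1) (fun h ↦ leaf₁ y h.1)
  · refine h.acyclic_right.of_forall_leaf fun x y hxy hn ↦ ?_
    rw [sup_adj, or_iff_right hn] at hxy
    exact hxy.2.imp (fun h ↦ leaf₂ x h.1) (fun h ↦ leaf₂ y h.1)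
  · intro w
    have := h.degree_left w
    have := hK w
    have := hs₁ w
    rcases trichotomy w with hw | hw | hw
    · exact .inl ((leaf₁ w hw).trans one_le_two)
    · omega
    · omega
  · intro w
    have := h.degree_right w
    have := hK w
    have := hs₂ w
    rcases trichotomy w with hw | hw | hw
    · exact .inl ((leaf₂ w hw).trans one_le_two)
    · omega
    · omega

end graphOn

/-- The even-indexed vertices of an alternating cycle together with the successor and predecessor
functions on them. -/
theorem exists_succ_pred_of_alternating (K : SimpleGraph V) {n : ℕ} {f : ℕ → V} (hn : 2 ≤ n)
    (hinj : ∀ i < 2 * n, ∀ j < 2 * n, f i = f j → i = j)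
    (hadj : ∀ i < 2 * n, K.Adj (f i) (f ((i + 1) % (2 * n))))
    (hdeg : ∀ i < 2 * n, i % 2 = 0 → (K.neighborSet (f i)).ncard = 2) :
    ∃ (A : Set V) (b c : V → V), A.Nonempty ∧ (∀ x ∈ A, b x ∉ A) ∧ (∀ x ∈ A, c x ∉ A) ∧
      A.InjOn b ∧ A.InjOn c ∧ (∀ x ∈ A, b x ≠ c x) ∧ b '' A = c '' A ∧
      (∀ x ∈ A, K.Adj x (b x)) ∧ (∀ x ∈ A, K.Adj x (c x)) ∧
      (∀ x ∈ A, (K.neighborSet x).ncard = 2) := by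
  have hex : ∃ g : V → ℕ, ∀ i < 2 * n, g (f i) = i := by
    have : Nonempty ℕ := ⟨0⟩
    have hi : Set.InjOn f (Set.Iio (2 * n)) := fun i hi j hj h ↦ hinj i hi j hj h
    exact ⟨Function.invFunOn f (Set.Iio (2 * n)), fun i h ↦ hi.leftInvOn_invFunOn h⟩
  obtain ⟨g, hg⟩ := hex
  let p : ℕ → ℕ := fun i ↦ if i = 0 then 2 * n - 1 else i - 1
  have hp : ∀ i, p i = if i = 0 then 2 * n - 1 else i - 1 := fun _ ↦ rfl
  refine ⟨f '' {i | i < 2 * n ∧ i % 2 = 0}, fun x ↦ f (g x + 1), fun x ↦ f (p (g x)),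
    ⟨f 0, 0, ⟨by omega, rfl⟩, rfl⟩, ?_, ?_, ?_, ?_, ?_, ?_, ?_, ?_, ?_⟩
  · rintro _ ⟨i, ⟨hi, hi'⟩, rfl⟩ ⟨j, ⟨hj, hj'⟩, h⟩
    simp only [hg i hi] at h
    have := hinj _ hj _ (by omega) h
    omega
  · rintro _ ⟨i, ⟨hi, hi'⟩, rfl⟩ ⟨j, ⟨hj, hj'⟩, h⟩
    simp only [hg i hi] at h
    have := hp i
    have := hinj _ hj _ (by split_ifs at this <;> omega) h
    split_ifs at * <;> omega
  · rintro _ ⟨i, ⟨hi, hi'⟩, rfl⟩ _ ⟨j, ⟨hj, hj'⟩, rfl⟩ h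
    simp only [hg i hi, hg j hj] at h
    have := hinj _ (by omega) _ (by omega) h
    congr 1
    omega
  · rintro _ ⟨i, ⟨hi, hi'⟩, rfl⟩ _ ⟨j, ⟨hj, hj'⟩, rfl⟩ h
    simp only [hg i hi, hg j hj] at h
    have h1 := hp i
    have h2 := hp j
    have := hinj _ (by split_ifs at h1 <;> omega) _ (by split_ifs at h2 <;> omega) h
    congr 1
    split_ifs at h1 h2 <;> omega
  · rintro _ ⟨i, ⟨hi, hi'⟩, rfl⟩ h
    simp only [hg i hi] at h
    have h1 := hp i
    have := hinj _ (by omega) _ (by split_ifs at h1 <;> omega) h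
    split_ifs at h1 <;> omega
  · ext y
    constructor
    · rintro ⟨_, ⟨i, ⟨hi, hi'⟩, rfl⟩, rfl⟩
      simp only [hg i hi]
      by_cases h : i + 2 < 2 * n
      · refine ⟨f (i + 2), ⟨i + 2, ⟨h, by omega⟩, rfl⟩, ?_⟩
        simp only [hg _ h]
        rw [hp, if_neg (by omega)]
        rfl
      · refine ⟨f 0, ⟨0, ⟨by omega, rfl⟩, rfl⟩, ?_⟩
        simp only [hg 0 (by omega)]
        rw [hp, if_pos rfl]
        congr 1
        omega
    · rintro ⟨_, ⟨i, ⟨hi, hi'⟩, rfl⟩, rfl⟩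
      simp only [hg i hi]
      rw [hp]
      split_ifs with h
      · refine ⟨f (2 * n - 2), ⟨2 * n - 2, ⟨by omega, by omega⟩, rfl⟩, ?_⟩
        simp only [hg _ (show 2 * n - 2 < 2 * n by omega)]
        congr 1
        omega
      · refine ⟨f (i - 2), ⟨i - 2, ⟨by omega, by omega⟩, rfl⟩, ?_⟩
        simp only [hg _ (show i - 2 < 2 * n by omega)]
        congr 1
        omega
  · rintro _ ⟨i, ⟨hi, hi'⟩, rfl⟩
    simp only [hg i hi]
    have := hadj i hi
    rwa [Nat.mod_eq_of_lt (by omega)] at this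
  · rintro _ ⟨i, ⟨hi, hi'⟩, rfl⟩
    simp only [hg i hi]
    rw [hp]
    split_ifs with h
    · have := hadj (2 * n - 1) (by omega)
      rw [Nat.sub_add_cancel (by omega), Nat.mod_self] at this
      exact h ▸ this.symm
    · have := hadj (i - 1) (by omega)
      rw [Nat.sub_add_cancel (by omega), Nat.mod_eq_of_lt hi] at this
      exact this.symm
  · rintro _ ⟨i, ⟨hi, hi'⟩, rfl⟩
    exact hdeg i hi hi'

theorem exists_isForestDecomposition [Finite V] {α : ℕ} (hα : 5 ≤ α) {G : SimpleGraph V}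
    (hG : ∀ G' : G.Subgraph, G'.verts.Nonempty →
      (∃ v ∈ G'.verts, (G'.neighborSet v).ncard ≤ 1) ∨
      (∃ u v, G'.Adj u v ∧ (G'.neighborSet u).ncard + (G'.neighborSet v).ncard ≤ α) ∨
      SubgraphHasTwoAlternatingCycle G')
    (K : SimpleGraph V) (hKG : K ≤ G) :
    ∃ F₁ F₂ H, IsForestDecomposition α K F₁ F₂ H := by
  induction K using WellFoundedLT.induction with
  | ind K ih =>
  have step {M : SimpleGraph V} (hM : M ≤ K) {u v : V} (huv : M.Adj u v) :
      ∃ F₁ F₂ H, IsForestDecomposition α (K \ M) F₁ F₂ H := by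
    refine ih _ (lt_of_le_of_ne sdiff_le fun h ↦ ?_) (sdiff_le.trans hKG)
    have := hM huv
    rw [← h] at this
    exact this.2 huv
  rcases eq_or_ne K ⊥ with rfl | hK
  · exact ⟨⊥, ⊥, ⊥, by simp, by simp, by simp, by simp, isAcyclic_bot, isAcyclic_bot,
      by simp, by simp, by simpa using fun _ ↦ hα⟩
  obtain ⟨a, b, hab⟩ := ne_bot_iff_exists_adj.mp hK
  let G' : G.Subgraph :=
    { verts := K.support
      Adj := K.Adj
      adj_sub := fun h ↦ hKG h
      edge_vert := fun h ↦ ⟨_, h⟩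
      symm := ⟨fun _ _ h ↦ h.symm⟩ }
  have hnb (x : V) : G'.neighborSet x = K.neighborSet x := rfl
  have edge_le {u v : V} (huv : K.Adj u v) : edge u v ≤ K := by
    rwa [edge_le_iff, or_iff_right huv.ne]
  have edge_self {u v : V} (huv : K.Adj u v) : (edge u v).Adj u v := by
    simp [edge_adj, huv.ne]
  have key := hG G' ⟨a, b, hab⟩
  by_cases hlight : ∃ u v, K.Adj u v ∧ (K.neighborSet u).ncard + (K.neighborSet v).ncard ≤ α
  · obtain ⟨u, v, huv, hle⟩ := hlight
    obtain ⟨F₁, F₂, H, h⟩ := step (edge_le huv) (edge_self huv)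
    exact h.exists_of_light_edge huv hle
  rcases key with ⟨u, ⟨v, huv⟩, hu⟩ | h | ⟨n, f, hn, hinj, hadj, hdeg⟩
  · obtain ⟨F₁, F₂, H, h⟩ := step (edge_le huv) (edge_self huv)
    exact h.exists_of_leaf huv hu
  · exact absurd h hlight
  · obtain ⟨A, b, c, ⟨x, hx⟩, hb, hc, hbi, hci, hbc, himage, hKb, hKc, hA⟩ :=
      K.exists_succ_pred_of_alternating hn hinj hadj hdeg
    have hle : graphOn A b ⊔ graphOn A c ≤ K := sup_le (graphOn_le hKb) (graphOn_le hKc)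
    obtain ⟨F₁, F₂, H, h⟩ := step hle (u := x) (v := b x)
      (.inl ⟨(hKb x hx).ne, .inl ⟨hx, rfl⟩⟩)
    refine ⟨_, _, _, h.add_alternating hb hc hbi hci hbc himage hKb hKc hA ?_⟩
    rintro _ ⟨y, hy, rfl⟩
    by_contra hlt
    have := hA y hy
    exact hlight ⟨y, b y, hKb y hy, by omega⟩

end SimpleGraph

theorem le_max_two_ceil {d k α : ℕ} (h : d ≤ 2 ∨ 2 * d + α ≤ k + 7) :
    (d : ℤ) ≤ max 2 ⌈((k : ℚ) - α + 6) / 2⌉ := by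
  rcases h with h | h
  · exact le_max_of_le_left (by exact_mod_cast h)
  · refine le_max_of_le_right (Int.le_ceil_iff.mpr ?_)
    have : (2 * d + α : ℚ) ≤ k + 7 := by exact_mod_cast h
    push_cast
    linarith

/-- Let `α ≥ 5` and let `G` be a finite simple graph such that every
(nonempty) subgraph `G'` of `G` has a vertex of degree at most 1, or contains an edge `uv`
with `d_{G'}(u) + d_{G'}(v) ≤ α`, or contains a 2-alternating cycle. Then `E(G)` can be
partitioned into two forests `F₁`, `F₂` and a subgraph `H` with
`d_{Fᵢ}(v) ≤ max {2, ⌈(d_G(v) - α + 6)/2⌉}` for every vertex `v` and `Δ(H) ≤ α - 5`. -/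
theorem statement0 {V : Type*} [Fintype V] (α : ℕ) (hα : 5 ≤ α) (G : SimpleGraph V)
    (hG : ∀ G' : G.Subgraph, G'.verts.Nonempty →
      (∃ v ∈ G'.verts, (G'.neighborSet v).ncard ≤ 1) ∨
      (∃ u v, G'.Adj u v ∧ (G'.neighborSet u).ncard + (G'.neighborSet v).ncard ≤ α) ∨
      SubgraphHasTwoAlternatingCycle G') :
    ∃ F₁ F₂ H : SimpleGraph V,
      EdgePartition3 G F₁ F₂ H ∧
      F₁.IsAcyclic ∧ F₂.IsAcyclic ∧
      (∀ v, ((F₁.neighborSet v).ncard : ℤ) ≤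
        max 2 ⌈(((G.neighborSet v).ncard : ℚ) - α + 6) / 2⌉) ∧
      (∀ v, ((F₂.neighborSet v).ncard : ℤ) ≤
        max 2 ⌈(((G.neighborSet v).ncard : ℚ) - α + 6) / 2⌉) ∧
      (∀ v, (H.neighborSet v).ncard ≤ α - 5) := by
  obtain ⟨F₁, F₂, H, h⟩ := SimpleGraph.exists_isForestDecomposition hα hG G le_rfl
  refine ⟨F₁, F₂, H, ⟨?_, ?_, ?_, ?_⟩, h.acyclic_left, h.acyclic_right,
    fun v ↦ le_max_two_ceil (h.degree_left v), fun v ↦ le_max_two_ceil (h.degree_right v),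
    fun v ↦ Nat.le_sub_of_add_le (h.degree_rest v)⟩
  · rw [← SimpleGraph.edgeSet_sup, ← SimpleGraph.edgeSet_sup, h.sup_eq]
  · exact SimpleGraph.disjoint_edgeSet.mpr h.disjoint
  · exact SimpleGraph.disjoint_edgeSet.mpr h.disjoint_left
  · exact SimpleGraph.disjoint_edgeSet.mpr h.disjoint_right
end

section
/- Let G be a finite simple graph with maximum degree Δ such that every subgraph G' of G satisfies at least one of: (i) G' has a vertex of degree at most 1; (ii) G' contains an edge uv with d_{G'}(u) + d_{G'}(v) ≤ 15; (iii) G' contains a 2-alternating cycle. Then the edge set of G can be partitioned into three pairwise disjoint sets inducing spanning subgraphs F₁, F₂, H such that F₁ and F₂ are forests with maximum degree at most max{2, ⌈(Δ − 9)/2⌉} and H has maximum degree at most 10. -/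
namespace SimpleGraph

variable {V : Type*}

/-- Adding edges that each have an endpoint of degree at most one creates no cycle. -/
theorem IsAcyclic.of_pendant {F F' : SimpleGraph V} (hF : F.IsAcyclic)
    (h : ∀ a b, F'.Adj a b → F.Adj a b ∨
      (F'.neighborSet a).Subsingleton ∨ (F'.neighborSet b).Subsingleton) :
    F'.IsAcyclic := by
  intro v c hc
  have key : ∀ a ∈ c.support, ¬ (F'.neighborSet a).Subsingleton := by
    intro a ha hs
    have h2 := hc.ncard_neighborSet_toSubgraph_eq_two ha
    have hs' : (c.toSubgraph.neighborSet a).Subsingleton :=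
      hs.anti (c.toSubgraph.neighborSet_subset a)
    have := (Set.ncard_le_one hs'.finite).2 hs'
    omega
  have hmem : ∀ e ∈ c.edges, e ∈ F.edgeSet := by
    intro e
    induction e with
    | _ a b =>
      intro he
      rcases h a b (c.adj_of_mem_edges he) with h | h | h
      · exact h
      · exact absurd h (key a (c.fst_mem_support_of_mem_edges he))
      · exact absurd h (key b (c.snd_mem_support_of_mem_edges he))
  exact hF _ (hc.transfer hmem)

/-- The degree allowed in the `i`-th class at a vertex of degree `d`: classes `0` and `1` are the
forests, class `2` is the remaining graph. -/
def classCap (i : Fin 3) (d : ℕ) : ℕ := if i = 2 then 10 else max 2 ((d - 8) / 2)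

theorem classCap_mono (i : Fin 3) {d e : ℕ} (h : d ≤ e) : classCap i d ≤ classCap i e := by
  unfold classCap
  split_ifs <;> omega

theorem two_le_classCap (i : Fin 3) (d : ℕ) : 2 ≤ classCap i d := by
  unfold classCap
  split_ifs <;> omega

/-- An edge partition of `G` into two forests and a third graph whose degrees are bounded, vertex
by vertex, in terms of the degrees of `G`. -/
structure IsForestPartition (G : SimpleGraph V) (F : Fin 3 → SimpleGraph V) : Prop where
  adj_iff : ∀ u v, G.Adj u v ↔ ∃ i, (F i).Adj u v
  unique : ∀ i j u v, (F i).Adj u v → (F j).Adj u v → i = j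
  acyclic : ∀ i, i ≠ 2 → (F i).IsAcyclic
  ncard_le : ∀ i v, ((F i).neighborSet v).ncard ≤ classCap i (G.neighborSet v).ncard

variable [Finite V] {G G₀ : SimpleGraph V} {F : Fin 3 → SimpleGraph V}

theorem ncard_neighborSet_mono (h : G₀ ≤ G) (v : V) :
    (G₀.neighborSet v).ncard ≤ (G.neighborSet v).ncard :=
  Set.ncard_le_ncard fun _ hx => h hx

theorem IsForestPartition.ncard_eq (hF : G.IsForestPartition F) (v : V) :
    (G.neighborSet v).ncard = ((F 0).neighborSet v).ncard + ((F 1).neighborSet v).ncard +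
      ((F 2).neighborSet v).ncard := by
  have hdisj : ∀ i j, i ≠ j → Disjoint ((F i).neighborSet v) ((F j).neighborSet v) :=
    fun i j hij => Set.disjoint_left.2 fun x hi hj => hij (hF.unique i j v x hi hj)
  rw [← Set.ncard_union_eq (hdisj 0 1 (by decide)), ← Set.ncard_union_eq]
  · congr 1
    ext x
    simp [hF.adj_iff, Fin.exists_fin_succ, or_assoc]
  · exact Set.disjoint_union_left.2 ⟨hdisj 0 2 (by decide), hdisj 1 2 (by decide)⟩

/-- An edge can be put into a class with room at both ends, provided that in a forest class one of
its ends is isolated. -/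
theorem IsForestPartition.add_edge (hF : G₀.IsForestPartition F) {u v : V} (huv : u ≠ v)
    (hG₀ : ¬ G₀.Adj u v)
    (hG : ∀ a b, G.Adj a b ↔ G₀.Adj a b ∨ (a = u ∧ b = v) ∨ (b = u ∧ a = v)) (c : Fin 3)
    (hu : ((F c).neighborSet u).ncard < classCap c (G.neighborSet u).ncard)
    (hv : ((F c).neighborSet v).ncard < classCap c (G.neighborSet v).ncard)
    (hc : c ≠ 2 → ((F c).neighborSet u).ncard = 0 ∨ ((F c).neighborSet v).ncard = 0) :
    ∃ F', G.IsForestPartition F' := by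
  have hle : G₀ ≤ G := fun a b h => (hG a b).2 (.inl h)
  have hsub : ∀ i a b, (F i).Adj a b → G₀.Adj a b := fun i a b h => (hF.adj_iff a b).2 ⟨i, h⟩
  let F' : Fin 3 → SimpleGraph V := fun i =>
    { Adj := fun a b => (F i).Adj a b ∨ i = c ∧ ((a = u ∧ b = v) ∨ (b = u ∧ a = v))
      symm := ⟨fun a b h => by
        rcases h with h | h
        · exact .inl h.symm
        · exact .inr ⟨h.1, h.2.symm⟩⟩
      loopless := ⟨fun a h => by
        rcases h with h | h
        · exact h.ne rfl
        · grind⟩ }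
  have hadj : ∀ i a b, (F' i).Adj a b ↔
      (F i).Adj a b ∨ i = c ∧ ((a = u ∧ b = v) ∨ (b = u ∧ a = v)) := fun _ _ _ => Iff.rfl
  refine ⟨F', ⟨?_, ?_, ?_, ?_⟩⟩
  · intro a b
    simp only [hadj, hG, hF.adj_iff, exists_or, exists_eq_left]
  · intro i j a b hi hj
    have := hF.unique i j a b
    have := hsub i a b
    have := hsub j a b
    have := G₀.adj_comm a b
    grind
  · intro i hi
    refine (hF.acyclic i hi).of_pendant fun a b hab => ?_
    have hpend : ∀ a b, (F i).neighborSet a = ∅ →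
        ((a = u ∧ b = v) ∨ (b = u ∧ a = v)) → ((F' i).neighborSet a).Subsingleton := by
      intro a b ha hab x hx y hy
      have hx' : ¬ (F i).Adj a x := fun h => (ha ▸ h : x ∈ (∅ : Set V))
      have hy' : ¬ (F i).Adj a y := fun h => (ha ▸ h : y ∈ (∅ : Set V))
      rw [mem_neighborSet, hadj] at hx hy
      grind
    rcases hab with hab | ⟨rfl, hab⟩
    · exact .inl hab
    · right
      rw [Set.ncard_eq_zero, Set.ncard_eq_zero] at hc
      rcases hc hi with h | h <;> rcases hab with ⟨rfl, rfl⟩ | ⟨rfl, rfl⟩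
      · exact .inl (hpend a b h (by simp))
      · exact .inr (hpend b a h (by simp))
      · exact .inr (hpend b a h (by simp))
      · exact .inl (hpend a b h (by simp))
  · intro i w
    by_cases hw : i = c ∧ (w = u ∨ w = v)
    · obtain ⟨rfl, rfl | rfl⟩ := hw
      · have : (F' i).neighborSet w ⊆ insert v ((F i).neighborSet w) := by
          intro x hx
          rw [mem_neighborSet, hadj] at hx
          simp only [Set.mem_insert_iff, mem_neighborSet]
          grind
        have h1 := Set.ncard_le_ncard this
        have h2 := Set.ncard_insert_le v ((F i).neighborSet w)
        omega
      · have : (F' i).neighborSet w ⊆ insert u ((F i).neighborSet w) := by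
          intro x hx
          rw [mem_neighborSet, hadj] at hx
          simp only [Set.mem_insert_iff, mem_neighborSet]
          grind
        have h1 := Set.ncard_le_ncard this
        have h2 := Set.ncard_insert_le u ((F i).neighborSet w)
        omega
    · have : (F' i).neighborSet w = (F i).neighborSet w := by
        ext x
        rw [mem_neighborSet, hadj, mem_neighborSet]
        grind
      rw [this]
      exact (hF.ncard_le i w).trans (classCap_mono i (ncard_neighborSet_mono hle w))

/-- A partition of `G` minus an edge `uv` extends to `G` if `v` is a leaf of `G`. -/
theorem IsForestPartition.add_leaf (hF : G₀.IsForestPartition F) {u v : V} (huv : u ≠ v)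
    (hG₀ : ¬ G₀.Adj u v)
    (hG : ∀ a b, G.Adj a b ↔ G₀.Adj a b ∨ (a = u ∧ b = v) ∨ (b = u ∧ a = v))
    (hu : (G₀.neighborSet u).ncard + 1 = (G.neighborSet u).ncard)
    (hv : (G₀.neighborSet v).ncard = 0) :
    ∃ F', G.IsForestPartition F' := by
  have hsv := hF.ncard_eq v
  have hsu := hF.ncard_eq u
  have hv0 : ∀ i, ((F i).neighborSet v).ncard = 0 := by
    intro i
    fin_cases i <;> simp only [Fin.zero_eta, Fin.mk_one, Fin.reduceFinMk] <;> omega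
  obtain ⟨c, hc⟩ : ∃ c, ((F c).neighborSet u).ncard < classCap c (G.neighborSet u).ncard := by
    by_contra! h
    have h0 := h 0
    have h1 := h 1
    have h2 := h 2
    simp only [classCap, show (0 : Fin 3) ≠ 2 by decide, show (1 : Fin 3) ≠ 2 by decide, if_true,
      if_false] at h0 h1 h2
    omega
  have := two_le_classCap c (G.neighborSet v).ncard
  exact hF.add_edge huv hG₀ hG c hc (by rw [hv0]; omega) fun _ => .inr (hv0 c)

/-- A partition of `G` minus a light edge extends to `G`. -/
theorem IsForestPartition.add_light (hF : G₀.IsForestPartition F) {u v : V} (huv : u ≠ v)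
    (hG₀ : ¬ G₀.Adj u v)
    (hG : ∀ a b, G.Adj a b ↔ G₀.Adj a b ∨ (a = u ∧ b = v) ∨ (b = u ∧ a = v))
    (h : (G₀.neighborSet u).ncard + (G₀.neighborSet v).ncard ≤ 13) :
    ∃ F', G.IsForestPartition F' := by
  rw [hF.ncard_eq u, hF.ncard_eq v] at h
  have hcap := fun c d => two_le_classCap c d
  have hadd := hF.add_edge huv hG₀ hG
  by_cases h2 : ((F 2).neighborSet u).ncard < 10 ∧ ((F 2).neighborSet v).ncard < 10
  · exact hadd 2 (by simpa [classCap] using h2.1) (by simpa [classCap] using h2.2)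
      fun h => absurd rfl h
  have hforest : ∀ c, ((F c).neighborSet u).ncard + ((F c).neighborSet v).ncard ≤ 1 →
      ∃ F', G.IsForestPartition F' := by
    intro c hc
    refine hadd c ?_ ?_ fun _ => by omega
    · have := hcap c (G.neighborSet u).ncard
      omega
    · have := hcap c (G.neighborSet v).ncard
      omega
  by_cases h0 : ((F 0).neighborSet u).ncard + ((F 0).neighborSet v).ncard ≤ 1
  · exact hforest 0 h0
  · exact hforest 1 (by omega)

/-- The combinatorial content of a union of 2-alternating cycles with set `S` of distinguished
vertices: every `s ∈ S` has exactly the two neighbours `p s` and `q s`, and `p` and `q` are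
injections of `S` onto the same set of vertices outside `S`. -/
structure IsAlternatingCover (G : SimpleGraph V) (S : Set V) (p q : V → V) : Prop where
  adj_iff : ∀ s ∈ S, ∀ v, G.Adj s v ↔ v = p s ∨ v = q s
  ne : ∀ s ∈ S, p s ≠ q s
  fst_notMem : ∀ s ∈ S, p s ∉ S
  snd_notMem : ∀ s ∈ S, q s ∉ S
  fst_injOn : Set.InjOn p S
  snd_injOn : Set.InjOn q S
  exists_snd : ∀ s ∈ S, ∃ t ∈ S, q t = p s
  exists_fst : ∀ s ∈ S, ∃ t ∈ S, p t = q s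

/-- A partition of `G` minus the distinguished vertices of alternating cycles extends to `G`. -/
theorem IsForestPartition.add_alternating {S : Set V} {p q : V → V} (hS : G.IsAlternatingCover S p q)
    (hG₀ : ∀ a b, G₀.Adj a b ↔ G.Adj a b ∧ a ∉ S ∧ b ∉ S) (hF : G₀.IsForestPartition F) :
    ∃ F', G.IsForestPartition F' := by
  classical
  have hle : G₀ ≤ G := fun a b h => ((hG₀ a b).1 h).1
  have hsub : ∀ i a b, (F i).Adj a b → G₀.Adj a b := fun i a b h => (hF.adj_iff a b).2 ⟨i, h⟩
  have hsub' : ∀ i a b, (F i).Adj a b → a ∉ S ∧ b ∉ S :=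
    fun i a b h => ((hG₀ a b).1 (hsub i a b h)).2
  let l : V → Fin 3 := fun w =>
    if ((F 0).neighborSet w).ncard < classCap 0 (G.neighborSet w).ncard then 0 else 2
  let r : V → Fin 3 := fun w =>
    if ((F 1).neighborSet w).ncard < classCap 1 (G.neighborSet w).ncard then 1 else 2
  have hl : ∀ w, l w ≠ 1 := by intro w; simp only [l]; split_ifs <;> decide
  have hr : ∀ w, r w ≠ 0 := by intro w; simp only [r]; split_ifs <;> decide
  let N : Fin 3 → V → V → Prop := fun i s w =>
    s ∈ S ∧ ((w = p s ∧ l w = i) ∨ (w = q s ∧ r w = i))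
  have hN : ∀ i s w, N i s w ↔ s ∈ S ∧ ((w = p s ∧ l w = i) ∨ (w = q s ∧ r w = i)) :=
    fun _ _ _ => Iff.rfl
  have hNS : ∀ i s w, N i s w → s ∈ S ∧ w ∉ S := by
    intro i s w h
    have h1 := hS.fst_notMem s h.1
    have h2 := hS.snd_notMem s h.1
    rw [hN] at h
    grind
  let F' : Fin 3 → SimpleGraph V := fun i =>
    { Adj := fun a b => (F i).Adj a b ∨ N i a b ∨ N i b a
      symm := ⟨fun a b h => by
        rcases h with h | h
        · exact .inl h.symm
        · exact .inr h.symm⟩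
      loopless := ⟨fun a h => by
        rcases h with h | h | h
        · exact h.ne rfl
        · exact (hNS _ _ _ h).2 (hNS _ _ _ h).1
        · exact (hNS _ _ _ h).2 (hNS _ _ _ h).1⟩ }
  have hadj : ∀ i a b, (F' i).Adj a b ↔ (F i).Adj a b ∨ N i a b ∨ N i b a :=
    fun _ _ _ => Iff.rfl
  have hNadj : ∀ s w, (∃ i, N i s w) ↔ s ∈ S ∧ G.Adj s w := by
    intro s w
    constructor
    · rintro ⟨i, hs, h⟩
      refine ⟨hs, (hS.adj_iff s hs w).2 ?_⟩
      grind
    · rintro ⟨hs, h⟩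
      rcases (hS.adj_iff s hs w).1 h with h | h
      · exact ⟨l w, hs, .inl ⟨h, rfl⟩⟩
      · exact ⟨r w, hs, .inr ⟨h, rfl⟩⟩
  have hNuniq : ∀ i j s w, N i s w → N j s w → i = j := by
    intro i j s w hi hj
    have := hS.ne s hi.1
    rw [hN] at hi hj
    grind
  -- neighbours of a distinguished vertex
  have hnbr : ∀ i s, s ∈ S → (F' i).neighborSet s ⊆ {p s, q s} := by
    intro i s hs w hw
    rw [mem_neighborSet, hadj] at hw
    have h1 := hsub' i s w
    have h2 := hNS i w s
    have h3 := hN i s w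
    simp only [Set.mem_insert_iff, Set.mem_singleton_iff]
    grind
  have hnbr' : ∀ i s, i ≠ 2 → s ∈ S → ((F' i).neighborSet s).Subsingleton := by
    intro i s hi hs x hx y hy
    rw [mem_neighborSet, hadj] at hx hy
    have hx1 := hsub' i s x
    have hx2 := hNS i x s
    have hx3 := hN i s x
    have hy1 := hsub' i s y
    have hy2 := hNS i y s
    have hy3 := hN i s y
    have a1 := hl x
    have a2 := hr x
    have a3 := hl y
    have a4 := hr y
    have : i = 0 ∨ i = 1 := by omega
    grind
  refine ⟨F', ⟨?_, ?_, ?_, ?_⟩⟩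
  · intro a b
    simp only [hadj, exists_or, hNadj, ← hF.adj_iff, hG₀, G.adj_comm b a]
    tauto
  · intro i j a b hi hj
    rw [hadj] at hi hj
    have h1 := hF.unique i j a b
    have h2 := hNuniq i j a b
    have h3 := hNuniq i j b a
    have h4 := hsub' i a b
    have h5 := hsub' j a b
    have h6 := hNS i a b
    have h7 := hNS j a b
    have h8 := hNS i b a
    have h9 := hNS j b a
    grind
  · intro i hi
    refine (hF.acyclic i hi).of_pendant fun a b hab => ?_
    rcases hab with h | h | h
    · exact .inl h
    · exact .inr (.inl (hnbr' i a hi h.1))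
    · exact .inr (.inr (hnbr' i b hi h.1))
  · intro i w
    by_cases hw : w ∈ S
    · calc ((F' i).neighborSet w).ncard ≤ ({p w, q w} : Set V).ncard :=
            Set.ncard_le_ncard (hnbr i w hw)
        _ = 2 := Set.ncard_pair (hS.ne w hw)
        _ ≤ _ := two_le_classCap _ _
    by_cases hW : ∃ s ∈ S, p s = w
    · obtain ⟨s, hs, rfl⟩ := hW
      obtain ⟨t, ht, hts⟩ := hS.exists_snd s hs
      set w := p s with hwdef
      have hst : s ≠ t := by
        rintro rfl
        exact hS.ne s hs hts.symm
      have hNw : ∀ i x, N i x w ↔ (x = s ∧ l w = i) ∨ (x = t ∧ r w = i) := by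
        intro i x
        constructor
        · rintro ⟨hx, ⟨h, h'⟩ | ⟨h, h'⟩⟩
          · exact .inl ⟨hS.fst_injOn hx hs h.symm, h'⟩
          · exact .inr ⟨hS.snd_injOn hx ht (h.symm.trans hts.symm), h'⟩
        · rintro (⟨rfl, h⟩ | ⟨rfl, h⟩)
          · exact ⟨hs, .inl ⟨rfl, h⟩⟩
          · exact ⟨ht, .inr ⟨hts.symm, h⟩⟩
      have hset : G.neighborSet w = G₀.neighborSet w ∪ {s, t} := by
        ext x
        have h1 := hNadj x w
        simp only [hNw] at h1
        have h2 := G.adj_comm w x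
        simp only [mem_neighborSet, Set.mem_union, hG₀, Set.mem_insert_iff, Set.mem_singleton_iff]
        grind
      have hdeg : (G.neighborSet w).ncard = (G₀.neighborSet w).ncard + 2 := by
        rw [hset, Set.ncard_union_eq, Set.ncard_pair hst]
        rw [Set.disjoint_left]
        intro x hx
        have := ((hG₀ w x).1 hx).2.2
        simp only [Set.mem_insert_iff, Set.mem_singleton_iff]
        grind
      have hsum := hF.ncard_eq w
      have h0 := hF.ncard_le 0 w
      have h1 := hF.ncard_le 1 w
      have h2 := hF.ncard_le 2 w
      have hFw : (F' i).neighborSet w ⊆ (F i).neighborSet w ∪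
          ((if l w = i then {s} else ∅) ∪ (if r w = i then {t} else ∅)) := by
        intro x hx
        rw [mem_neighborSet, hadj, hNw] at hx
        have h3 := hNS i w x
        simp only [Set.mem_union, mem_neighborSet]
        split_ifs <;> simp only [Set.mem_singleton_iff, Set.mem_empty_iff_false] <;> grind
      have hbound : ((F' i).neighborSet w).ncard ≤ ((F i).neighborSet w).ncard +
          ((if l w = i then 1 else 0) + (if r w = i then 1 else 0)) := by
        refine (Set.ncard_le_ncard hFw).trans ((Set.ncard_union_le _ _).trans ?_)
        refine Nat.add_le_add_left ((Set.ncard_union_le _ _).trans ?_) _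
        split_ifs <;> simp
      refine hbound.trans ?_
      clear hbound hFw
      have hlw : l w = if ((F 0).neighborSet w).ncard < classCap 0 (G.neighborSet w).ncard
        then 0 else 2 := rfl
      have hrw : r w = if ((F 1).neighborSet w).ncard < classCap 1 (G.neighborSet w).ncard
        then 1 else 2 := rfl
      rw [hdeg] at hlw hrw ⊢
      have e0 : (0 : Fin 3) ≠ 2 := by decide
      have e1 : (1 : Fin 3) ≠ 2 := by decide
      simp only [classCap, e0, e1, if_true, if_false] at h0 h1 h2 hlw hrw ⊢
      have hi : i = 0 ∨ i = 1 ∨ i = 2 := by omega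
      rw [hlw, hrw]
      clear_value l r
      rcases hi with rfl | rfl | rfl <;> split_ifs <;>
        simp only [Fin.reduceEq, not_true_eq_false] at * <;> omega
    · have : (F' i).neighborSet w = (F i).neighborSet w := by
        ext x
        rw [mem_neighborSet, hadj, mem_neighborSet]
        have h1 : ¬ N i w x := fun h => hw h.1
        have h2 : ¬ N i x w := by
          rintro ⟨hx, ⟨h, -⟩ | ⟨h, -⟩⟩
          · exact hW ⟨x, hx, h.symm⟩
          · obtain ⟨t, ht, h'⟩ := hS.exists_fst x hx
            exact hW ⟨t, ht, h'.trans h.symm⟩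
        simp [h1, h2]
      rw [this]
      exact (hF.ncard_le i w).trans (classCap_mono i (ncard_neighborSet_mono hle w))

/-- A 2-alternating cycle gives the data of `IsAlternatingCover`. -/
theorem exists_isAlternatingCover {n : ℕ} {f : ℕ → V} (hn : 2 ≤ n)
    (hinj : ∀ i < 2 * n, ∀ j < 2 * n, f i = f j → i = j)
    (hadj : ∀ i < 2 * n, G.Adj (f i) (f ((i + 1) % (2 * n))))
    (hdeg : ∀ i < 2 * n, i % 2 = 0 → (G.neighborSet (f i)).ncard = 2) :
    ∃ (S : Set V) (p q : V → V), f 0 ∈ S ∧ G.IsAlternatingCover S p q := by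
  classical
  obtain ⟨g, hg⟩ : ∃ g : V → ℕ, ∀ i < 2 * n, g (f i) = i := by
    refine ⟨fun v => if h : ∃ i < 2 * n, f i = v then h.choose else 0, fun i hi => ?_⟩
    have h : ∃ j < 2 * n, f j = f i := ⟨i, hi, rfl⟩
    simp only [dif_pos h]
    exact hinj _ h.choose_spec.1 _ hi h.choose_spec.2
  let pv : ℕ → ℕ := fun i => if i = 0 then 2 * n - 1 else i - 1
  have hS : ∀ s ∈ {v | ∃ i < 2 * n, i % 2 = 0 ∧ f i = v},
      ∃ i < 2 * n, i % 2 = 0 ∧ g s = i ∧ s = f i := by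
    rintro s ⟨i, hi, hi', rfl⟩
    exact ⟨i, hi, hi', hg i hi, rfl⟩
  have hpv : ∀ i < 2 * n, i % 2 = 0 → pv i < 2 * n ∧ pv i % 2 = 1 ∧ pv i ≠ i + 1 ∧
      (pv i + 1) % (2 * n) = i := by
    intro i hi hi'
    simp only [pv]
    split_ifs with h
    · subst h
      refine ⟨by omega, by omega, by omega, ?_⟩
      rw [Nat.sub_add_cancel (by omega), Nat.mod_self]
    · refine ⟨by omega, by omega, by omega, ?_⟩
      rw [Nat.sub_add_cancel (by omega), Nat.mod_eq_of_lt hi]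
  have hodd : ∀ i < 2 * n, i % 2 = 1 → f i ∉ {v | ∃ i < 2 * n, i % 2 = 0 ∧ f i = v} := by
    rintro i hi hi' ⟨j, hj, hj', h⟩
    have := hinj j hj i hi h
    omega
  refine ⟨{v | ∃ i < 2 * n, i % 2 = 0 ∧ f i = v}, fun v => f (g v + 1), fun v => f (pv (g v)),
    ⟨0, by omega, rfl, rfl⟩, ⟨?_, ?_, ?_, ?_, ?_, ?_, ?_, ?_⟩⟩
  · intro s hs v
    obtain ⟨i, hi, hi', hgs, rfl⟩ := hS s hs
    obtain ⟨h1, h2, h3, h4⟩ := hpv i hi hi'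
    rw [hgs]
    have hne : f (i + 1) ≠ f (pv i) := fun h => h3 (hinj _ (by omega) _ h1 h).symm
    have ha := hadj i hi
    rw [Nat.mod_eq_of_lt (by omega)] at ha
    have hb := hadj (pv i) h1
    rw [h4] at hb
    have hsub : {f (i + 1), f (pv i)} ⊆ G.neighborSet (f i) := by
      rintro x (rfl | rfl)
      · exact ha
      · exact hb.symm
    have heq := Set.eq_of_subset_of_ncard_le hsub (by rw [Set.ncard_pair hne, hdeg i hi hi'])
    rw [← mem_neighborSet, ← heq]
    simp
  · intro s hs
    obtain ⟨i, hi, hi', hgs, rfl⟩ := hS s hs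
    obtain ⟨h1, h2, h3, h4⟩ := hpv i hi hi'
    rw [hgs]
    exact fun h => h3 (hinj _ (by omega) _ h1 h).symm
  · intro s hs
    obtain ⟨i, hi, hi', hgs, rfl⟩ := hS s hs
    rw [hgs]
    exact hodd _ (by omega) (by omega)
  · intro s hs
    obtain ⟨i, hi, hi', hgs, rfl⟩ := hS s hs
    obtain ⟨h1, h2, h3, h4⟩ := hpv i hi hi'
    rw [hgs]
    exact hodd _ h1 h2
  · intro s hs t ht h
    obtain ⟨i, hi, hi', hgs, rfl⟩ := hS s hs
    obtain ⟨j, hj, hj', hgt, rfl⟩ := hS t ht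
    simp only [hgs, hgt] at h
    have := hinj _ (by omega) _ (by omega) h
    rw [show i = j by omega]
  · intro s hs t ht h
    obtain ⟨i, hi, hi', hgs, rfl⟩ := hS s hs
    obtain ⟨j, hj, hj', hgt, rfl⟩ := hS t ht
    simp only [hgs, hgt] at h
    obtain ⟨h1, -, -, h2⟩ := hpv i hi hi'
    obtain ⟨h3, -, -, h4⟩ := hpv j hj hj'
    have := hinj _ h1 _ h3 h
    rw [← h2, ← h4, this]
  · intro s hs
    obtain ⟨i, hi, hi', hgs, rfl⟩ := hS s hs
    rcases Nat.lt_or_ge (i + 2) (2 * n) with h | h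
    · refine ⟨f (i + 2), ⟨i + 2, h, by omega, rfl⟩, ?_⟩
      simp [hgs, hg _ h, pv]
    · refine ⟨f 0, ⟨0, by omega, rfl, rfl⟩, ?_⟩
      simp only [hgs, hg 0 (by omega), pv, if_true]
      congr 1
      omega
  · intro s hs
    obtain ⟨i, hi, hi', hgs, rfl⟩ := hS s hs
    obtain ⟨h1, h2, h3, h4⟩ := hpv i hi hi'
    refine ⟨f (pv i - 1), ⟨pv i - 1, by omega, by omega, rfl⟩, ?_⟩
    simp only [hgs, hg (pv i - 1) (by omega)]
    congr 1
    omega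

/-- Deleting an edge lowers the degree of its end by one. -/
theorem ncard_neighborSet_deleteEdges_add_one {u v : V} (h : G.Adj u v) :
    ((G.deleteEdges {s(u, v)}).neighborSet u).ncard + 1 = (G.neighborSet u).ncard := by
  have : (G.deleteEdges {s(u, v)}).neighborSet u = G.neighborSet u \ {v} := by
    ext x
    simp only [mem_neighborSet, deleteEdges_adj, Set.mem_singleton_iff, Set.mem_sdiff, Sym2.eq_iff]
    grind
  rw [this]
  exact Set.ncard_sdiff_singleton_add_one h

/-- A graph all of whose subgraphs have a leaf or an isolated vertex, a light edge or a
2-alternating cycle has a partition into two forests and a third graph with bounded degrees. -/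
theorem exists_isForestPartition (G : SimpleGraph V)
    (hG : ∀ G' : G.Subgraph, G'.verts.Nonempty →
      (∃ v ∈ G'.verts, (G'.neighborSet v).ncard ≤ 1) ∨
      (∃ u v, G'.Adj u v ∧ (G'.neighborSet u).ncard + (G'.neighborSet v).ncard ≤ 15) ∨
      SubgraphHasTwoAlternatingCycle G') (G' : SimpleGraph V) (hle : G' ≤ G) :
    ∃ F, G'.IsForestPartition F := by
  induction G' using WellFoundedLT.induction with
  | _ G' ih =>
  by_cases hbot : G' = ⊥
  · subst hbot
    refine ⟨fun _ => ⊥, ⟨by simp, by simp, fun _ _ => isAcyclic_bot, fun i v => ?_⟩⟩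
    simp
  have hdel : ∀ u v, G'.Adj u v → ∃ F, (G'.deleteEdges {s(u, v)}).IsForestPartition F := by
    intro u v huv
    refine ih _ (lt_of_le_of_ne (deleteEdges_le _) fun h => ?_) ((deleteEdges_le _).trans hle)
    rw [← h] at huv
    simp at huv
  have hdel' : ∀ u v, G'.Adj u v → ∀ a b, G'.Adj a b ↔ (G'.deleteEdges {s(u, v)}).Adj a b ∨
      (a = u ∧ b = v) ∨ (b = u ∧ a = v) := by
    intro u v huv a b
    have := huv.symm
    simp only [deleteEdges_adj, Set.mem_singleton_iff, Sym2.eq_iff]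
    grind
  have hdeg : ∀ u v, G'.Adj u v → ((G'.deleteEdges {s(u, v)}).neighborSet u).ncard + 1 =
      (G'.neighborSet u).ncard ∧ ((G'.deleteEdges {s(u, v)}).neighborSet v).ncard + 1 =
      (G'.neighborSet v).ncard := by
    intro u v huv
    refine ⟨ncard_neighborSet_deleteEdges_add_one huv, ?_⟩
    rw [Sym2.eq_swap]
    exact ncard_neighborSet_deleteEdges_add_one huv.symm
  let K : G.Subgraph :=
    { verts := G'.support
      Adj := G'.Adj
      adj_sub := fun h => hle h
      edge_vert := fun {a b} h => ⟨b, h⟩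
      symm := G'.symm }
  have hK : ∀ v, K.neighborSet v = G'.neighborSet v := fun _ => rfl
  have hne : K.verts.Nonempty := by
    obtain ⟨u, v, h⟩ := ne_bot_iff_exists_adj.1 hbot
    exact ⟨u, v, h⟩
  rcases hG K hne with ⟨v, ⟨u, hvu⟩, hv⟩ | ⟨u, v, huv, h⟩ | ⟨n, f, hn, hinj, hadj, hd⟩
  · obtain ⟨F, hF⟩ := hdel u v hvu.symm
    obtain ⟨h1, h2⟩ := hdeg u v hvu.symm
    rw [hK] at hv
    exact hF.add_leaf hvu.ne' (by simp) (hdel' u v hvu.symm) h1 (by omega)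
  · have huv : G'.Adj u v := huv
    obtain ⟨F, hF⟩ := hdel u v huv
    obtain ⟨h1, h2⟩ := hdeg u v huv
    rw [hK, hK] at h
    exact hF.add_light huv.ne (by simp) (hdel' u v huv) (by omega)
  · obtain ⟨S, p, q, h0, hS⟩ := exists_isAlternatingCover (G := G') hn hinj hadj hd
    let G₀ : SimpleGraph V :=
      { Adj := fun a b => G'.Adj a b ∧ a ∉ S ∧ b ∉ S
        symm := ⟨fun a b h => ⟨h.1.symm, h.2.2, h.2.1⟩⟩
        loopless := ⟨fun a h => h.1.ne rfl⟩ }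
    have hG₀ : G₀ ≤ G' := fun a b h => h.1
    obtain ⟨F, hF⟩ := ih G₀ (lt_of_le_of_ne hG₀ fun h => by
      have h1 : G'.Adj (f 0) (p (f 0)) := (hS.adj_iff _ h0 _).2 (.inl rfl)
      rw [← h] at h1
      exact h1.2.1 h0) (hG₀.trans hle)
    exact IsForestPartition.add_alternating hS (fun _ _ => Iff.rfl) hF

end SimpleGraph

/-- Let `G` be a finite simple graph with maximum degree `Δ` such that
every (nonempty) subgraph `G'` of `G` has a vertex of degree at most 1, or contains an
edge `uv` with `d_{G'}(u) + d_{G'}(v) ≤ 15`, or contains a 2-alternating cycle. Then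
`E(G)` can be partitioned into two forests `F₁`, `F₂` and a subgraph `H` with
`Δ(Fᵢ) ≤ max {2, ⌈(Δ - 9)/2⌉}` and `Δ(H) ≤ 10`. -/
theorem statement2 {V : Type*} [Fintype V] (G : SimpleGraph V)
    [DecidableRel G.Adj] (Δ : ℕ) (hΔ : Δ = G.maxDegree)
    (hG : ∀ G' : G.Subgraph, G'.verts.Nonempty →
      (∃ v ∈ G'.verts, (G'.neighborSet v).ncard ≤ 1) ∨
      (∃ u v, G'.Adj u v ∧ (G'.neighborSet u).ncard + (G'.neighborSet v).ncard ≤ 15) ∨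
      SubgraphHasTwoAlternatingCycle G') :
    ∃ F₁ F₂ H : SimpleGraph V,
      EdgePartition3 G F₁ F₂ H ∧
      F₁.IsAcyclic ∧ F₂.IsAcyclic ∧
      (∀ v, ((F₁.neighborSet v).ncard : ℤ) ≤ max 2 ⌈((Δ : ℚ) - 9) / 2⌉) ∧
      (∀ v, ((F₂.neighborSet v).ncard : ℤ) ≤ max 2 ⌈((Δ : ℚ) - 9) / 2⌉) ∧
      (∀ v, (H.neighborSet v).ncard ≤ 10) := by
  obtain ⟨F, hF⟩ := SimpleGraph.exists_isForestPartition G hG G le_rfl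
  have hdisj : ∀ i j, i ≠ j → Disjoint (F i).edgeSet (F j).edgeSet := by
    intro i j hij
    rw [Set.disjoint_left]
    rintro ⟨a, b⟩ hi hj
    exact hij (hF.unique i j a b hi hj)
  have hforest : ∀ i, i ≠ 2 → ∀ v,
      (((F i).neighborSet v).ncard : ℤ) ≤ max 2 ⌈((Δ : ℚ) - 9) / 2⌉ := by
    intro i hi v
    have h1 := hF.ncard_le i v
    have h2 : (G.neighborSet v).ncard ≤ Δ := by
      rw [hΔ, Set.ncard_eq_toFinset_card', Set.toFinset_card, SimpleGraph.card_neighborSet_eq_degree]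
      exact G.degree_le_maxDegree v
    have h3 := h1.trans (SimpleGraph.classCap_mono i h2)
    simp only [SimpleGraph.classCap, if_neg hi] at h3
    rcases le_max_iff.1 h3 with h | h
    · exact le_max_of_le_left (by exact_mod_cast h)
    · rcases Nat.lt_or_ge Δ 8 with h8 | h8
      · exact le_max_of_le_left (by omega)
      · refine le_max_of_le_right (Int.le_ceil_iff.2 ?_)
        have h4 : (2 * ((F i).neighborSet v).ncard + 8 : ℚ) ≤ Δ := by
          have : 2 * ((F i).neighborSet v).ncard + 8 ≤ Δ := by omega
          exact_mod_cast this
        push_cast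
        linarith
  refine ⟨F 0, F 1, F 2, ⟨?_, hdisj 0 1 (by decide), hdisj 0 2 (by decide), hdisj 1 2 (by decide)⟩,
    hF.acyclic 0 (by decide), hF.acyclic 1 (by decide), hforest 0 (by decide),
    hforest 1 (by decide), fun v => by simpa [SimpleGraph.classCap] using hF.ncard_le 2 v⟩
  ext ⟨a, b⟩
  change (((F 0).Adj a b ∨ (F 1).Adj a b) ∨ (F 2).Adj a b) ↔ G.Adj a b
  simp [hF.adj_iff, Fin.exists_fin_succ, or_assoc]
end

section
/- Let G be a finite simple graph with maximum degree Δ such that every subgraph G' of G satisfies at least one of: (i) G' has a vertex of degree at most 1; (ii) G' contains an edge uv with d_{G'}(u) + d_{G'}(v) ≤ 10; (iii) G' contains a 2-alternating cycle. Then the edge set of G can be partitioned into three pairwise disjoint sets inducing spanning subgraphs F₁, F₂, H such that F₁ and F₂ are forests with maximum degree at most max{2, ⌈(Δ − 4)/2⌉} and H has maximum degree at most 5. -/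
namespace SimpleGraph

variable {V : Type*}

/-- The bound `max {2, ⌈(d - 4)/2⌉}` on the degrees in the forests. -/
def forestBound (d : ℕ) : ℕ := max 2 ((d - 3) / 2)

/-- A partition of the edges of `G` into two forests and a graph of maximum degree at most `5`,
where the degrees in the forests are bounded in terms of the degree in `G` at each vertex. -/
structure IsForestDecomp (G F₁ F₂ H : SimpleGraph V) : Prop where
  adj_iff : ∀ a b, G.Adj a b ↔ F₁.Adj a b ∨ F₂.Adj a b ∨ H.Adj a b
  disj₁₂ : ∀ a b, F₁.Adj a b → ¬ F₂.Adj a b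
  disj₁₃ : ∀ a b, F₁.Adj a b → ¬ H.Adj a b
  disj₂₃ : ∀ a b, F₂.Adj a b → ¬ H.Adj a b
  acyclic₁ : F₁.IsAcyclic
  acyclic₂ : F₂.IsAcyclic
  bound₁ : ∀ v, (F₁.neighborSet v).ncard ≤ forestBound (G.neighborSet v).ncard
  bound₂ : ∀ v, (F₂.neighborSet v).ncard ≤ forestBound (G.neighborSet v).ncard
  bound₃ : ∀ v, (H.neighborSet v).ncard ≤ 5

lemma IsAcyclic.of_subsingleton_neighborSet {F F' : SimpleGraph V} (hF : F.IsAcyclic) (A : Set V)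
    (hA : ∀ a ∈ A, (F'.neighborSet a).Subsingleton)
    (h : ∀ a b, F'.Adj a b → a ∉ A → b ∉ A → F.Adj a b) : F'.IsAcyclic := by
  intro v c hc
  have key : ∀ w ∈ c.support, w ∉ A := by
    intro w hw hwA
    have h2 := hc.ncard_neighborSet_toSubgraph_eq_two hw
    obtain ⟨a, b, hab, hs⟩ := Set.ncard_eq_two.1 h2
    have hsub := c.toSubgraph.neighborSet_subset w
    rw [hs] at hsub
    exact hab (hA w hwA (hsub (by simp)) (hsub (by simp)))
  have he : ∀ e ∈ c.edges, e ∈ F.edgeSet := by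
    intro e he
    induction e with
    | _ a b =>
      exact h a b (c.adj_of_mem_edges he) (key a (c.fst_mem_support_of_mem_edges he))
        (key b (c.snd_mem_support_of_mem_edges he))
  exact hF _ (hc.transfer he)

lemma IsForestDecomp.ncard_neighborSet [Finite V] {G F₁ F₂ H : SimpleGraph V}
    (h : IsForestDecomp G F₁ F₂ H) (v : V) :
    (G.neighborSet v).ncard =
      (F₁.neighborSet v).ncard + (F₂.neighborSet v).ncard + (H.neighborSet v).ncard := by
  have e : G.neighborSet v = F₁.neighborSet v ∪ F₂.neighborSet v ∪ H.neighborSet v := by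
    ext w
    simp [h.adj_iff, or_assoc]
  rw [e, Set.ncard_union_eq, Set.ncard_union_eq]
  · exact Set.disjoint_left.2 fun w => h.disj₁₂ v w
  · exact Set.disjoint_left.2 fun w hw => hw.elim (h.disj₁₃ v w) (h.disj₂₃ v w)

lemma IsForestDecomp.symm {G F₁ F₂ H : SimpleGraph V}
    (h : IsForestDecomp G F₁ F₂ H) : IsForestDecomp G F₂ F₁ H where
  adj_iff a b := by rw [h.adj_iff]; tauto
  disj₁₂ a b h₁ h₂ := h.disj₁₂ a b h₂ h₁
  disj₁₃ := h.disj₂₃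
  disj₂₃ := h.disj₁₃
  acyclic₁ := h.acyclic₂
  acyclic₂ := h.acyclic₁
  bound₁ := h.bound₂
  bound₂ := h.bound₁
  bound₃ := h.bound₃

lemma adj_sup_edge_iff {F : SimpleGraph V} {u v : V} (huv : u ≠ v) (a b : V) :
    (F ⊔ edge u v).Adj a b ↔ F.Adj a b ∨ (a = u ∧ b = v ∨ a = v ∧ b = u) := by
  simp only [sup_adj, edge_adj]
  grind

lemma ncard_neighborSet_sup_edge_le [Finite V] (F : SimpleGraph V) (u v w : V) :
    ((F ⊔ edge u v).neighborSet w).ncard ≤ (F.neighborSet w).ncard + 1 ∧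
      (w ≠ u → w ≠ v → ((F ⊔ edge u v).neighborSet w).ncard ≤ (F.neighborSet w).ncard) := by
  constructor
  · by_cases hw : w = u
    · refine (Set.ncard_le_ncard (t := insert v (F.neighborSet w)) ?_).trans
        (Set.ncard_insert_le _ _)
      intro z
      simp only [mem_neighborSet, sup_adj, edge_adj, Set.mem_insert_iff]
      grind
    · refine (Set.ncard_le_ncard (t := insert u (F.neighborSet w)) ?_).trans
        (Set.ncard_insert_le _ _)
      intro z
      simp only [mem_neighborSet, sup_adj, edge_adj, Set.mem_insert_iff]
      grind
  · intro hu hv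
    refine Set.ncard_le_ncard ?_
    intro z
    simp only [mem_neighborSet, sup_adj, edge_adj]
    grind

lemma isAcyclic_sup_edge_of_isolated {F : SimpleGraph V} (hF : F.IsAcyclic) {u v : V}
    (hu : F.neighborSet u = ∅) : (F ⊔ edge u v).IsAcyclic := by
  refine hF.of_subsingleton_neighborSet {u} ?_ ?_
  · rintro a rfl b hb c hc
    have h : ∀ w, ¬ F.Adj a w := fun w hw => (hu ▸ hw : w ∈ (∅ : Set V))
    simp only [mem_neighborSet, sup_adj, edge_adj] at hb hc
    grind
  · intro a b
    simp only [sup_adj, edge_adj, Set.mem_singleton_iff]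
    grind

lemma forestBound_mono {a b : ℕ} (h : a ≤ b) : forestBound a ≤ forestBound b := by
  unfold forestBound
  omega

lemma IsForestDecomp.addEdge_forest [Finite V] {G G₀ F₁ F₂ H : SimpleGraph V}
    (h : IsForestDecomp G₀ F₁ F₂ H) {u v : V} (huv : ¬ G₀.Adj u v) (hne : u ≠ v)
    (hG : G = G₀ ⊔ edge u v)
    (hiso : F₁.neighborSet u = ∅ ∨ F₁.neighborSet v = ∅)
    (hu : (F₁.neighborSet u).ncard + 1 ≤ forestBound (G.neighborSet u).ncard)
    (hv : (F₁.neighborSet v).ncard + 1 ≤ forestBound (G.neighborSet v).ncard) :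
    IsForestDecomp G (F₁ ⊔ edge u v) F₂ H := by
  have hvu : ¬ G₀.Adj v u := fun h => huv h.symm
  have hmono (w) : forestBound (G₀.neighborSet w).ncard ≤ forestBound (G.neighborSet w).ncard :=
    forestBound_mono (Set.ncard_le_ncard fun z hz => hG ▸ Or.inl hz)
  have hi := h.adj_iff
  refine ⟨?_, ?_, ?_, h.disj₂₃, ?_, h.acyclic₂, ?_, fun w => (h.bound₂ w).trans (hmono w),
    h.bound₃⟩
  · intro a b
    rw [hG, adj_sup_edge_iff hne, adj_sup_edge_iff hne, hi]
    tauto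
  · intro a b
    rw [adj_sup_edge_iff hne]
    have := h.disj₁₂ a b
    grind
  · intro a b
    rw [adj_sup_edge_iff hne]
    have := h.disj₁₃ a b
    grind
  · rcases hiso with hu | hv
    · exact isAcyclic_sup_edge_of_isolated h.acyclic₁ hu
    · rw [edge_comm]
      exact isAcyclic_sup_edge_of_isolated h.acyclic₁ hv
  · intro w
    obtain ⟨h1, h2⟩ := ncard_neighborSet_sup_edge_le F₁ u v w
    by_cases hwu : w = u
    · subst hwu; exact h1.trans hu
    by_cases hwv : w = v
    · subst hwv; exact h1.trans hv
    exact (h2 hwu hwv).trans ((h.bound₁ w).trans (hmono w))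

lemma IsForestDecomp.addEdge_bounded [Finite V] {G G₀ F₁ F₂ H : SimpleGraph V}
    (h : IsForestDecomp G₀ F₁ F₂ H) {u v : V} (huv : ¬ G₀.Adj u v) (hne : u ≠ v)
    (hG : G = G₀ ⊔ edge u v)
    (hu : (H.neighborSet u).ncard ≤ 4) (hv : (H.neighborSet v).ncard ≤ 4) :
    IsForestDecomp G F₁ F₂ (H ⊔ edge u v) := by
  have hvu : ¬ G₀.Adj v u := fun h => huv h.symm
  have hmono (w) : forestBound (G₀.neighborSet w).ncard ≤ forestBound (G.neighborSet w).ncard :=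
    forestBound_mono (Set.ncard_le_ncard fun z hz => hG ▸ Or.inl hz)
  have hi := h.adj_iff
  refine ⟨?_, h.disj₁₂, ?_, ?_, h.acyclic₁, h.acyclic₂, fun w => (h.bound₁ w).trans (hmono w),
    fun w => (h.bound₂ w).trans (hmono w), ?_⟩
  · intro a b
    rw [hG, adj_sup_edge_iff hne, adj_sup_edge_iff hne, hi]
    tauto
  · intro a b
    rw [adj_sup_edge_iff hne]
    have := h.disj₁₃ a b
    grind
  · intro a b
    rw [adj_sup_edge_iff hne]
    have := h.disj₂₃ a b
    grind
  · intro w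
    obtain ⟨h1, h2⟩ := ncard_neighborSet_sup_edge_le H u v w
    by_cases hwu : w = u
    · subst hwu; omega
    by_cases hwv : w = v
    · subst hwv; omega
    exact (h2 hwu hwv).trans (h.bound₃ w)

/-- A forest decomposition extends over an edge that ends in a leaf or has small degree sum. -/
lemma IsForestDecomp.exists_addEdge [Finite V] {G G₀ F₁ F₂ H : SimpleGraph V}
    (h : IsForestDecomp G₀ F₁ F₂ H) {u v : V} (huv : ¬ G₀.Adj u v) (hne : u ≠ v)
    (hG : G = G₀ ⊔ edge u v)
    (hdeg : (G₀.neighborSet v).ncard = 0 ∨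
      (G₀.neighborSet u).ncard + (G₀.neighborSet v).ncard ≤ 8) :
    ∃ F₁ F₂ H, IsForestDecomp G F₁ F₂ H := by
  wlog hH : (H.neighborSet v).ncard ≤ (H.neighborSet u).ncard generalizing u v
  · refine this (fun h => huv h.symm) hne.symm (by rw [hG, edge_comm]) ?_ (by omega)
    have := h.ncard_neighborSet v
    omega
  have hcard : ∀ w z, ¬ G₀.Adj w z → G.Adj w z →
      (G₀.neighborSet w).ncard + 1 ≤ (G.neighborSet w).ncard := by
    intro w z hwz hwz'
    refine Set.ncard_lt_ncard ⟨fun y hy => hG ▸ Or.inl hy, fun hs => hwz (hs hwz')⟩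
  have hadj : G.Adj u v := by rw [hG, adj_sup_edge_iff hne]; tauto
  have hdu := hcard u v huv hadj
  have hdv := hcard v u (fun h => huv h.symm) hadj.symm
  have hsu := h.ncard_neighborSet u
  have hsv := h.ncard_neighborSet v
  have hbu := h.bound₃ u
  have hzero : ∀ (F : SimpleGraph V) (w : V), (F.neighborSet w).ncard = 0 →
      F.neighborSet w = ∅ := fun F w hw => (Set.ncard_eq_zero).1 hw
  by_cases hHu : (H.neighborSet u).ncard ≤ 4
  · exact ⟨_, _, _, h.addEdge_bounded huv hne hG hHu (hH.trans hHu)⟩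
  have hsplit : ((F₁.neighborSet u).ncard = 0 ∨ (F₁.neighborSet v).ncard = 0) ∧
      (F₁.neighborSet u).ncard + 1 ≤ forestBound (G.neighborSet u).ncard ∧
      (F₁.neighborSet v).ncard + 1 ≤ forestBound (G.neighborSet v).ncard ∨
      ((F₂.neighborSet u).ncard = 0 ∨ (F₂.neighborSet v).ncard = 0) ∧
      (F₂.neighborSet u).ncard + 1 ≤ forestBound (G.neighborSet u).ncard ∧
      (F₂.neighborSet v).ncard + 1 ≤ forestBound (G.neighborSet v).ncard := by
    unfold forestBound
    omega
  rcases hsplit with ⟨h0, h1, h2⟩ | ⟨h0, h1, h2⟩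
  · exact ⟨_, _, _, h.addEdge_forest huv hne hG (h0.imp (hzero _ _) (hzero _ _)) h1 h2⟩
  · exact ⟨_, _, _, h.symm.addEdge_forest huv hne hG (h0.imp (hzero _ _) (hzero _ _)) h1 h2⟩

/-- The graph with edges `x i — y i` for all `i` satisfying `p`. -/
def linkGraph {ι : Type*} (x y : ι → V) (p : ι → Prop) : SimpleGraph V :=
  fromRel fun a b => ∃ i, p i ∧ a = x i ∧ b = y i

section linkGraph

variable {ι : Type*} {x y : ι → V} {p q : ι → Prop}

lemma linkGraph_adj_left (hx : x.Injective) (hxy : ∀ i j, x i ≠ y j) (i : ι) (z : V) :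
    (linkGraph x y p).Adj (x i) z ↔ p i ∧ z = y i := by
  simp only [linkGraph, fromRel_adj]
  constructor
  · rintro ⟨-, ⟨j, hj, hij, hz⟩ | ⟨j, hj, -, hij⟩⟩
    · cases hx hij
      exact ⟨hj, hz⟩
    · exact absurd hij (hxy i j)
  · rintro ⟨hi, rfl⟩
    exact ⟨hxy i i, Or.inl ⟨i, hi, rfl, rfl⟩⟩

lemma linkGraph_adj_right (hy : y.Injective) (hxy : ∀ i j, x i ≠ y j) (i : ι) (z : V) :
    (linkGraph x y p).Adj (y i) z ↔ p i ∧ z = x i := by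
  simp only [linkGraph, fromRel_adj]
  constructor
  · rintro ⟨-, ⟨j, hj, hij, hz⟩ | ⟨j, hj, hz, hij⟩⟩
    · exact absurd hij.symm (hxy j i)
    · cases hy hij
      exact ⟨hj, hz⟩
  · rintro ⟨hi, rfl⟩
    exact ⟨(hxy i i).symm, Or.inr ⟨i, hi, rfl, rfl⟩⟩

lemma linkGraph_adj_other {w : V} (hwx : w ∉ Set.range x) (hwy : w ∉ Set.range y) (z : V) :
    ¬ (linkGraph x y p).Adj w z := by
  simp only [linkGraph, fromRel_adj]
  rintro ⟨-, ⟨j, hj, rfl, -⟩ | ⟨j, hj, -, rfl⟩⟩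
  · exact hwx ⟨j, rfl⟩
  · exact hwy ⟨j, rfl⟩

end linkGraph

lemma ncard_le_add_one_of_subset_insert [Finite V] {s t : Set V} {a : V} (h : s ⊆ insert a t) :
    s.ncard ≤ t.ncard + 1 :=
  (Set.ncard_le_ncard h).trans (Set.ncard_insert_le _ _)

/-- Where to put the two cycle edges at a vertex of degree `d`, of which the remaining
`d₀` edges are already distributed: the first edge goes to the first forest if `p` holds,
the second one to the second forest if `q` holds, and they go to the bounded part otherwise. -/
lemma exists_link_choice {d d₀ f₁ f₂ h : ℕ} (hd : d = d₀ + 2) (hs : d₀ = f₁ + f₂ + h)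
    (b₁ : f₁ ≤ forestBound d₀) (b₂ : f₂ ≤ forestBound d₀) (b₃ : h ≤ 5) :
    ∃ p q : Prop, (p → f₁ + 1 ≤ forestBound d) ∧ (q → f₂ + 1 ≤ forestBound d) ∧
      (¬ p → h + 1 ≤ 5) ∧ (¬ q → h + 1 ≤ 5) ∧ (¬ p → ¬ q → h + 2 ≤ 5) := by
  refine ⟨h = 5 ∨ h = 4 ∧ f₁ + 1 ≤ forestBound d, h = 5 ∨ h = 4 ∧ ¬ f₁ + 1 ≤ forestBound d, ?_⟩
  unfold forestBound at *
  omega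

set_option maxHeartbeats 800000 in
/-- A forest decomposition extends over a union of cycles in which every second vertex
has degree two. -/
lemma IsForestDecomp.exists_addCycles [Finite V] {G G₀ F₁ F₂ H : SimpleGraph V}
    (h : IsForestDecomp G₀ F₁ F₂ H) {ι : Type*} {x y : ι → V} (σ : Equiv.Perm ι)
    (hx : x.Injective) (hy : y.Injective) (hxy : ∀ i j, x i ≠ y j) (hσ : ∀ i, σ i ≠ i)
    (h₁ : ∀ i, G.Adj (x i) (y i)) (h₂ : ∀ i, G.Adj (y i) (x (σ i)))
    (hdeg : ∀ i, (G.neighborSet (x i)).ncard = 2)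
    (hG : G₀ = G \ (linkGraph x y (fun _ => True) ⊔ linkGraph (x ∘ σ) y (fun _ => True))) :
    ∃ F₁ F₂ H, IsForestDecomp G F₁ F₂ H := by
  have hx' : (x ∘ σ).Injective := hx.comp σ.injective
  have hxy' : ∀ i j, (x ∘ σ) i ≠ y j := fun i j => hxy _ _
  have L1 := fun (p : ι → Prop) => linkGraph_adj_left (p := p) hx hxy
  have R1 := fun (p : ι → Prop) => linkGraph_adj_right (p := p) hy hxy
  have L2 : ∀ (p : ι → Prop) i z,
      (linkGraph (x ∘ σ) y p).Adj (x i) z ↔ p (σ.symm i) ∧ z = y (σ.symm i) := by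
    intro p i z
    simpa using linkGraph_adj_left (p := p) hx' hxy' (σ.symm i) z
  have R2 := fun (p : ι → Prop) => linkGraph_adj_right (p := p) hy hxy'
  have hσ' : ∀ i, σ.symm i ≠ i := fun i hi => hσ i (by simpa using (congrArg σ hi).symm)
  have hGx : ∀ i z, G.Adj (x i) z ↔ z = y i ∨ z = y (σ.symm i) := by
    intro i z
    have hsub : ({y i, y (σ.symm i)} : Set V) ⊆ G.neighborSet (x i) := by
      rintro w (rfl | rfl)
      · exact h₁ i
      · simpa using (h₂ (σ.symm i)).symm
    have hc : ({y i, y (σ.symm i)} : Set V).ncard = 2 :=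
      Set.ncard_pair fun hi => hσ' i (hy hi).symm
    have he := Set.eq_of_subset_of_ncard_le hsub (by rw [hc, hdeg])
    exact (Set.ext_iff.1 he z).symm
  have hG₀x : ∀ i z, ¬ G₀.Adj (x i) z := by
    intro i z hz
    rw [hG, sdiff_adj, sup_adj, L1, L2, hGx] at hz
    tauto
  have hG₀y : ∀ i z, G.Adj (y i) z ↔ z = x i ∨ z = x (σ i) ∨ G₀.Adj (y i) z := by
    intro i z
    rw [hG, sdiff_adj, sup_adj, R1, R2]
    have a := (h₁ i).symm
    have b := h₂ i
    constructor
    · intro hz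
      simp only [Function.comp_apply]
      tauto
    · rintro (rfl | rfl | hz)
      exacts [a, b, hz.1]
  have hG₀o : ∀ w, w ∉ Set.range x → w ∉ Set.range y → ∀ z, G.Adj w z ↔ G₀.Adj w z := by
    intro w hwx hwy z
    have hwx' : w ∉ Set.range (x ∘ σ) := fun ⟨j, hj⟩ => hwx ⟨σ j, hj⟩
    rw [hG, sdiff_adj, sup_adj]
    have a := linkGraph_adj_other (p := fun _ => True) hwx hwy z
    have b := linkGraph_adj_other (p := fun _ => True) hwx' hwy z
    tauto
  have hdy : ∀ i, (G.neighborSet (y i)).ncard = (G₀.neighborSet (y i)).ncard + 2 := by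
    intro i
    have e : G.neighborSet (y i) = insert (x i) (insert (x (σ i)) (G₀.neighborSet (y i))) := by
      ext z
      exact hG₀y i z
    rw [e, Set.ncard_insert_of_notMem, Set.ncard_insert_of_notMem]
    · exact fun hz => hG₀x _ _ (G₀.adj_symm hz)
    · rintro (hz | hz)
      · exact hσ i (hx hz).symm
      · exact hG₀x _ _ (G₀.adj_symm hz)
  have hpoint := fun i => exists_link_choice (hdy i) (h.ncard_neighborSet (y i))
    (h.bound₁ (y i)) (h.bound₂ (y i)) (h.bound₃ (y i))
  choose p q hpq using hpoint
  have hmono (w) : forestBound (G₀.neighborSet w).ncard ≤ forestBound (G.neighborSet w).ncard := by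
    refine forestBound_mono (Set.ncard_le_ncard fun z hz => ?_)
    rw [hG] at hz
    exact hz.1
  have hF₁x : ∀ i z, ¬ F₁.Adj (x i) z := fun i z hz => hG₀x i z ((h.adj_iff _ _).2 (by tauto))
  have hF₂x : ∀ i z, ¬ F₂.Adj (x i) z := fun i z hz => hG₀x i z ((h.adj_iff _ _).2 (by tauto))
  have hHx : ∀ i z, ¬ H.Adj (x i) z := fun i z hz => hG₀x i z ((h.adj_iff _ _).2 (by tauto))
  have F1x : ∀ i z, (F₁ ⊔ linkGraph x y p).Adj (x i) z ↔ p i ∧ z = y i := by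
    intro i z
    rw [sup_adj, L1]
    simp [hF₁x]
  have F2x : ∀ i z, (F₂ ⊔ linkGraph (x ∘ σ) y q).Adj (x i) z ↔
      q (σ.symm i) ∧ z = y (σ.symm i) := by
    intro i z
    rw [sup_adj, L2]
    simp [hF₂x]
  have Hx : ∀ i z, (H ⊔ (linkGraph x y (fun i => ¬ p i) ⊔
      linkGraph (x ∘ σ) y (fun i => ¬ q i))).Adj (x i) z ↔
      ¬ p i ∧ z = y i ∨ ¬ q (σ.symm i) ∧ z = y (σ.symm i) := by
    intro i z
    rw [sup_adj, sup_adj, L1, L2]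
    simp [hHx]
  have F1y : ∀ i z, (F₁ ⊔ linkGraph x y p).Adj (y i) z ↔ F₁.Adj (y i) z ∨ p i ∧ z = x i := by
    intro i z
    rw [sup_adj, R1]
  have F2y : ∀ i z, (F₂ ⊔ linkGraph (x ∘ σ) y q).Adj (y i) z ↔
      F₂.Adj (y i) z ∨ q i ∧ z = x (σ i) := by
    intro i z
    rw [sup_adj, R2, Function.comp_apply]
  have Hy : ∀ i z, (H ⊔ (linkGraph x y (fun i => ¬ p i) ⊔
      linkGraph (x ∘ σ) y (fun i => ¬ q i))).Adj (y i) z ↔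
      H.Adj (y i) z ∨ ¬ p i ∧ z = x i ∨ ¬ q i ∧ z = x (σ i) := by
    intro i z
    rw [sup_adj, sup_adj, R1, R2, Function.comp_apply]
  have other : ∀ w, w ∉ Set.range x → w ∉ Set.range y → ∀ z,
      ((F₁ ⊔ linkGraph x y p).Adj w z ↔ F₁.Adj w z) ∧
      ((F₂ ⊔ linkGraph (x ∘ σ) y q).Adj w z ↔ F₂.Adj w z) ∧
      ((H ⊔ (linkGraph x y (fun i => ¬ p i) ⊔
        linkGraph (x ∘ σ) y (fun i => ¬ q i))).Adj w z ↔ H.Adj w z) := by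
    intro w hwx hwy z
    have hwx' : w ∉ Set.range (x ∘ σ) := fun ⟨j, hj⟩ => hwx ⟨σ j, hj⟩
    simp [linkGraph_adj_other hwx hwy, linkGraph_adj_other hwx' hwy]
  have hyy : ∀ i, y i ≠ y (σ.symm i) := fun i hi => hσ' i (hy hi).symm
  have hxx : ∀ i, x i ≠ x (σ i) := fun i hi => hσ i (hx hi).symm
  have cases : ∀ w, (∃ i, w = x i) ∨ (∃ i, w = y i) ∨ (w ∉ Set.range x ∧ w ∉ Set.range y) := by
    intro w
    by_cases a : w ∈ Set.range x
    · exact Or.inl (a.imp fun _ h => h.symm)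
    by_cases b : w ∈ Set.range y
    · exact Or.inr (Or.inl (b.imp fun _ h => h.symm))
    exact Or.inr (Or.inr ⟨a, b⟩)
  have hF₁y : ∀ i z, F₁.Adj (y i) z → z ≠ x i ∧ z ≠ x (σ i) := by
    rintro i z hz
    exact ⟨fun e => hF₁x i (y i) (e ▸ hz.symm), fun e => hF₁x (σ i) (y i) (e ▸ hz.symm)⟩
  have hF₂y : ∀ i z, F₂.Adj (y i) z → z ≠ x i ∧ z ≠ x (σ i) := by
    rintro i z hz
    exact ⟨fun e => hF₂x i (y i) (e ▸ hz.symm), fun e => hF₂x (σ i) (y i) (e ▸ hz.symm)⟩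
  have hHy : ∀ i z, H.Adj (y i) z → z ≠ x i ∧ z ≠ x (σ i) := by
    rintro i z hz
    exact ⟨fun e => hHx i (y i) (e ▸ hz.symm), fun e => hHx (σ i) (y i) (e ▸ hz.symm)⟩
  refine ⟨F₁ ⊔ linkGraph x y p, F₂ ⊔ linkGraph (x ∘ σ) y q,
    H ⊔ (linkGraph x y (fun i => ¬ p i) ⊔ linkGraph (x ∘ σ) y (fun i => ¬ q i)),
    ?_, ?_, ?_, ?_, ?_, ?_, ?_, ?_, ?_⟩
  · intro a b
    rcases cases a with ⟨i, rfl⟩ | ⟨i, rfl⟩ | ⟨hax, hay⟩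
    · rw [hGx, F1x, F2x, Hx]
      tauto
    · rw [hG₀y, F1y, F2y, Hy, h.adj_iff]
      tauto
    · obtain ⟨o1, o2, o3⟩ := other a hax hay b
      rw [hG₀o a hax hay, o1, o2, o3, h.adj_iff]
  · intro a b
    rcases cases a with ⟨i, rfl⟩ | ⟨i, rfl⟩ | ⟨hax, hay⟩
    · rw [F1x, F2x]
      have := hyy i
      grind
    · rw [F1y, F2y]
      have := h.disj₁₂ (y i) b
      have := hxx i
      have := hF₁y i b
      have := hF₂y i b
      grind
    · obtain ⟨o1, o2, o3⟩ := other a hax hay b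
      rw [o1, o2]
      exact h.disj₁₂ a b
  · intro a b
    rcases cases a with ⟨i, rfl⟩ | ⟨i, rfl⟩ | ⟨hax, hay⟩
    · rw [F1x, Hx]
      have := hyy i
      grind
    · rw [F1y, Hy]
      have := h.disj₁₃ (y i) b
      have := hxx i
      have := hF₁y i b
      have := hHy i b
      grind
    · obtain ⟨o1, o2, o3⟩ := other a hax hay b
      rw [o1, o3]
      exact h.disj₁₃ a b
  · intro a b
    rcases cases a with ⟨i, rfl⟩ | ⟨i, rfl⟩ | ⟨hax, hay⟩
    · rw [F2x, Hx]
      have := hyy i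
      grind
    · rw [F2y, Hy]
      have := h.disj₂₃ (y i) b
      have := hxx i
      have := hF₂y i b
      have := hHy i b
      grind
    · obtain ⟨o1, o2, o3⟩ := other a hax hay b
      rw [o2, o3]
      exact h.disj₂₃ a b
  · refine h.acyclic₁.of_subsingleton_neighborSet (Set.range x) ?_ ?_
    · rintro _ ⟨i, rfl⟩ b hb c hc
      exact ((F1x i b).1 hb).2.trans ((F1x i c).1 hc).2.symm
    · intro a b hab ha hb
      rcases cases a with ⟨i, rfl⟩ | ⟨i, rfl⟩ | ⟨hax, hay⟩
      · exact absurd ⟨i, rfl⟩ ha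
      · exact ((F1y i b).1 hab).resolve_right fun e => hb ⟨i, e.2.symm⟩
      · exact (other a hax hay b).1.1 hab
  · refine h.acyclic₂.of_subsingleton_neighborSet (Set.range x) ?_ ?_
    · rintro _ ⟨i, rfl⟩ b hb c hc
      exact ((F2x i b).1 hb).2.trans ((F2x i c).1 hc).2.symm
    · intro a b hab ha hb
      rcases cases a with ⟨i, rfl⟩ | ⟨i, rfl⟩ | ⟨hax, hay⟩
      · exact absurd ⟨i, rfl⟩ ha
      · exact ((F2y i b).1 hab).resolve_right fun e => hb ⟨σ i, e.2.symm⟩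
      · exact (other a hax hay b).2.1.1 hab
  · intro w
    rcases cases w with ⟨i, rfl⟩ | ⟨i, rfl⟩ | ⟨hax, hay⟩
    · refine (Set.ncard_le_ncard (t := {y i}) fun z hz => ((F1x i z).1 hz).2).trans ?_
      rw [Set.ncard_singleton]
      unfold forestBound
      omega
    · by_cases hp : p i
      · exact (ncard_le_add_one_of_subset_insert fun z hz =>
          (((F1y i z).1 hz).imp_right And.right).symm).trans ((hpq i).1 hp)
      · exact (Set.ncard_le_ncard fun z hz =>
          ((F1y i z).1 hz).resolve_right fun e => hp e.1).trans ((h.bound₁ _).trans (hmono _))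
    · exact (Set.ncard_le_ncard fun z hz => (other w hax hay z).1.1 hz).trans
        ((h.bound₁ _).trans (hmono _))
  · intro w
    rcases cases w with ⟨i, rfl⟩ | ⟨i, rfl⟩ | ⟨hax, hay⟩
    · refine (Set.ncard_le_ncard (t := {y (σ.symm i)}) fun z hz => ((F2x i z).1 hz).2).trans ?_
      rw [Set.ncard_singleton]
      unfold forestBound
      omega
    · by_cases hq : q i
      · exact (ncard_le_add_one_of_subset_insert fun z hz =>
          (((F2y i z).1 hz).imp_right And.right).symm).trans ((hpq i).2.1 hq)
      · exact (Set.ncard_le_ncard fun z hz =>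
          ((F2y i z).1 hz).resolve_right fun e => hq e.1).trans ((h.bound₂ _).trans (hmono _))
    · exact (Set.ncard_le_ncard fun z hz => (other w hax hay z).2.1.1 hz).trans
        ((h.bound₂ _).trans (hmono _))
  · intro w
    rcases cases w with ⟨i, rfl⟩ | ⟨i, rfl⟩ | ⟨hax, hay⟩
    · refine (Set.ncard_le_ncard (t := G.neighborSet (x i)) fun z hz => ?_).trans
        ((hdeg i).le.trans (by norm_num))
      have := (Hx i z).1 hz
      exact (hGx i z).2 (by tauto)
    · obtain ⟨-, -, hp', hq', hpq'⟩ := hpq i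
      by_cases hp : p i <;> by_cases hq : q i
      · refine (Set.ncard_le_ncard fun z hz => ?_).trans (h.bound₃ (y i))
        have := (Hy i z).1 hz
        exact this.resolve_right (by tauto)
      · refine (ncard_le_add_one_of_subset_insert (a := x (σ i)) fun z hz => ?_).trans (hq' hq)
        have := (Hy i z).1 hz
        rw [Set.mem_insert_iff, mem_neighborSet]
        tauto
      · refine (ncard_le_add_one_of_subset_insert (a := x i) fun z hz => ?_).trans (hp' hp)
        have := (Hy i z).1 hz
        rw [Set.mem_insert_iff, mem_neighborSet]
        tauto
      · refine (ncard_le_add_one_of_subset_insert (a := x i)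
          (t := insert (x (σ i)) (H.neighborSet (y i))) fun z hz => ?_).trans ?_
        · have := (Hy i z).1 hz
          rw [Set.mem_insert_iff, Set.mem_insert_iff, mem_neighborSet]
          tauto
        · have := Set.ncard_insert_le (x (σ i)) (H.neighborSet (y i))
          have := hpq' hp hq
          omega
    · exact (Set.ncard_le_ncard fun z hz => (other w hax hay z).2.2.1 hz).trans (h.bound₃ _)

lemma isForestDecomp_bot : IsForestDecomp (⊥ : SimpleGraph V) ⊥ ⊥ ⊥ where
  adj_iff := by simp
  disj₁₂ := by simp
  disj₁₃ := by simp
  disj₂₃ := by simp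
  acyclic₁ := isAcyclic_bot
  acyclic₂ := isAcyclic_bot
  bound₁ v := by simp [neighborSet]
  bound₂ v := by simp [neighborSet]
  bound₃ v := by simp [neighborSet]

lemma sdiff_edge_sup_edge {G : SimpleGraph V} {u v : V} (h : G.Adj u v) :
    G = G \ edge u v ⊔ edge u v :=
  (sdiff_sup_cancel ((edge_le_iff G).2 (Or.inr h))).symm

lemma not_adj_sdiff_edge {G : SimpleGraph V} {u v : V} (h : u ≠ v) :
    ¬ (G \ edge u v).Adj u v := by
  simp [sdiff_adj, edge_adj, h]

lemma ncard_neighborSet_sdiff_edge_lt [Finite V] {G : SimpleGraph V} {u v : V} (h : G.Adj u v) :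
    ((G \ edge u v).neighborSet u).ncard < (G.neighborSet u).ncard :=
  Set.ncard_lt_ncard ⟨fun _ hz => hz.1, fun hs => not_adj_sdiff_edge h.ne (hs h)⟩

lemma exists_isForestDecomp_of_adj [Finite V] {G : SimpleGraph V}
    (ih : ∀ G₀ < G, ∃ F₁ F₂ H, IsForestDecomp G₀ F₁ F₂ H) {u v : V} (h : G.Adj u v)
    (hdeg : (G.neighborSet v).ncard ≤ 1 ∨
      (G.neighborSet u).ncard + (G.neighborSet v).ncard ≤ 10) :
    ∃ F₁ F₂ H, IsForestDecomp G F₁ F₂ H := by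
  obtain ⟨F₁, F₂, H, hF⟩ := ih (G \ edge u v)
    ⟨sdiff_le, fun hle => not_adj_sdiff_edge h.ne (hle _ _ h)⟩
  refine hF.exists_addEdge (not_adj_sdiff_edge h.ne) h.ne (sdiff_edge_sup_edge h) ?_
  have hu := ncard_neighborSet_sdiff_edge_lt h
  have hv := ncard_neighborSet_sdiff_edge_lt h.symm
  rw [edge_comm] at hv
  omega

/-- A 2-alternating cycle, with its even vertices `x`, its odd vertices `y`
and its rotation `σ`. -/
lemma exists_perm_of_twoAlternatingCycle {G : SimpleGraph V} {G' : G.Subgraph}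
    (h : SubgraphHasTwoAlternatingCycle G') :
    ∃ (n : ℕ) (x y : Fin n → V) (σ : Equiv.Perm (Fin n)), 0 < n ∧ x.Injective ∧ y.Injective ∧
      (∀ i j, x i ≠ y j) ∧ (∀ i, σ i ≠ i) ∧ (∀ i, G'.Adj (x i) (y i)) ∧
      (∀ i, G'.Adj (y i) (x (σ i))) ∧ ∀ i, (G'.neighborSet (x i)).ncard = 2 := by
  obtain ⟨n, f, hn, hf, hadj, hdeg⟩ := h
  have hmod : ∀ i < n, (i + 1) % n = if i + 1 = n then 0 else i + 1 := by
    intro i hi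
    split_ifs with h
    · rw [h, Nat.mod_self]
    · exact Nat.mod_eq_of_lt (by omega)
  let s : Fin n → Fin n := fun i => ⟨(i + 1) % n, Nat.mod_lt _ (by omega)⟩
  have hs : s.Injective := by
    intro i j hij
    have h : (i.1 + 1) % n = (j.1 + 1) % n := congrArg Fin.val hij
    rw [hmod _ i.2, hmod _ j.2] at h
    ext
    split_ifs at h <;> omega
  refine ⟨n, fun i => f (2 * i), fun i => f (2 * i + 1),
    Equiv.ofBijective s (Finite.injective_iff_bijective.1 hs), by omega, ?_, ?_, ?_, ?_, ?_, ?_, ?_⟩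
  · intro i j hij
    have := hf _ (by omega) _ (by omega) hij
    omega
  · intro i j hij
    have := hf _ (by omega) _ (by omega) hij
    omega
  · intro i j hij
    have := hf _ (by omega) _ (by omega) hij
    omega
  · intro i hi
    have h : (i.1 + 1) % n = i.1 := congrArg Fin.val hi
    rw [hmod _ i.2] at h
    split_ifs at h <;> omega
  · intro i
    have := hadj (2 * i) (by omega)
    rwa [Nat.mod_eq_of_lt (by omega)] at this
  · intro i
    have := hadj (2 * i + 1) (by omega)
    rwa [show 2 * i.1 + 1 + 1 = 2 * (i.1 + 1) by ring, Nat.mul_mod_mul_left] at this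
  · intro i
    exact hdeg _ (by omega) (by omega)

lemma exists_isForestDecomp [Finite V] (G : SimpleGraph V)
    (hG : ∀ G' : G.Subgraph, G'.verts.Nonempty →
      (∃ v ∈ G'.verts, (G'.neighborSet v).ncard ≤ 1) ∨
      (∃ u v, G'.Adj u v ∧ (G'.neighborSet u).ncard + (G'.neighborSet v).ncard ≤ 10) ∨
      SubgraphHasTwoAlternatingCycle G') (K : SimpleGraph V) (hK : K ≤ G) :
    ∃ F₁ F₂ H, IsForestDecomp K F₁ F₂ H := by
  induction K using WellFoundedLT.induction with
  | ind K ih =>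
    replace ih : ∀ G₀ < K, ∃ F₁ F₂ H, IsForestDecomp G₀ F₁ F₂ H :=
      fun G₀ h => ih G₀ h (h.le.trans hK)
    rcases eq_or_ne K ⊥ with rfl | hne
    · exact ⟨_, _, _, isForestDecomp_bot⟩
    obtain ⟨a, b, hab⟩ := ne_bot_iff_exists_adj.1 hne
    let G' : G.Subgraph :=
      { verts := K.support
        Adj := K.Adj
        adj_sub := fun h => hK h
        edge_vert := fun h => ⟨_, h⟩
        symm := K.symm }
    rcases hG G' ⟨a, b, hab⟩ with ⟨v, ⟨u, hvu⟩, hv⟩ | ⟨u, v, huv, hd⟩ | hc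
    · exact exists_isForestDecomp_of_adj ih hvu.symm (Or.inl hv)
    · exact exists_isForestDecomp_of_adj ih huv (Or.inr hd)
    · obtain ⟨n, x, y, σ, hn, hx, hy, hxy, hσ, h₁, h₂, hdeg⟩ :=
        exists_perm_of_twoAlternatingCycle hc
      obtain ⟨F₁, F₂, H, hF⟩ := ih
        (K \ (linkGraph x y (fun _ => True) ⊔ linkGraph (x ∘ σ) y (fun _ => True)))
        ⟨sdiff_le, fun hle => (hle _ _ (h₁ ⟨0, hn⟩)).2
          (Or.inl ((linkGraph_adj_left hx hxy _ _).2 ⟨trivial, rfl⟩))⟩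
      exact hF.exists_addCycles σ hx hy hxy hσ h₁ h₂ hdeg rfl

lemma forestBound_le {d D : ℕ} (h : d ≤ D) :
    (forestBound d : ℤ) ≤ max 2 ⌈((D : ℚ) - 4) / 2⌉ := by
  have hD : (((D : ℤ) - 3) / 2) ≤ ⌈((D : ℚ) - 4) / 2⌉ := by
    rw [Int.le_ceil_iff]
    have h1 : ((D : ℤ) - 3) / 2 * 2 ≤ (D : ℤ) - 3 := Int.ediv_mul_le _ (by norm_num)
    have h2 : ((((D : ℤ) - 3) / 2 : ℤ) : ℚ) * 2 ≤ (D : ℚ) - 3 := by exact_mod_cast h1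
    linarith
  unfold forestBound
  omega

end SimpleGraph

/-- Let `G` be a finite simple graph with maximum degree `Δ` such that
every (nonempty) subgraph `G'` of `G` has a vertex of degree at most 1, or contains an
edge `uv` with `d_{G'}(u) + d_{G'}(v) ≤ 10`, or contains a 2-alternating cycle. Then
`E(G)` can be partitioned into two forests `F₁`, `F₂` and a subgraph `H` with
`Δ(Fᵢ) ≤ max {2, ⌈(Δ - 4)/2⌉}` and `Δ(H) ≤ 5`. -/
theorem statement3 {V : Type*} [Fintype V] (G : SimpleGraph V)
    [DecidableRel G.Adj] (Δ : ℕ) (hΔ : Δ = G.maxDegree)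
    (hG : ∀ G' : G.Subgraph, G'.verts.Nonempty →
      (∃ v ∈ G'.verts, (G'.neighborSet v).ncard ≤ 1) ∨
      (∃ u v, G'.Adj u v ∧ (G'.neighborSet u).ncard + (G'.neighborSet v).ncard ≤ 10) ∨
      SubgraphHasTwoAlternatingCycle G') :
    ∃ F₁ F₂ H : SimpleGraph V,
      EdgePartition3 G F₁ F₂ H ∧
      F₁.IsAcyclic ∧ F₂.IsAcyclic ∧
      (∀ v, ((F₁.neighborSet v).ncard : ℤ) ≤ max 2 ⌈((Δ : ℚ) - 4) / 2⌉) ∧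
      (∀ v, ((F₂.neighborSet v).ncard : ℤ) ≤ max 2 ⌈((Δ : ℚ) - 4) / 2⌉) ∧
      (∀ v, (H.neighborSet v).ncard ≤ 5) := by
  obtain ⟨F₁, F₂, H, h⟩ := G.exists_isForestDecomp hG G le_rfl
  have hle (v : V) : (G.neighborSet v).ncard ≤ Δ := by
    rw [hΔ, Set.ncard_eq_toFinset_card', ← SimpleGraph.neighborFinset_def]
    exact G.degree_le_maxDegree v
  refine ⟨F₁, F₂, H, ⟨?_, ?_, ?_, ?_⟩, h.acyclic₁, h.acyclic₂,
    fun v => (Nat.cast_le.2 (h.bound₁ v)).trans (SimpleGraph.forestBound_le (hle v)),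
    fun v => (Nat.cast_le.2 (h.bound₂ v)).trans (SimpleGraph.forestBound_le (hle v)), h.bound₃⟩
  · ext e
    induction e with
    | _ a b => simp [h.adj_iff, or_assoc]
  · exact Set.disjoint_left.2 fun e => e.ind h.disj₁₂
  · exact Set.disjoint_left.2 fun e => e.ind h.disj₁₃
  · exact Set.disjoint_left.2 fun e => e.ind h.disj₂₃
end

section
/- Let G be a finite simple graph with maximum degree Δ such that every subgraph G' of G satisfies at least one of: (i) G' has a vertex of degree at most 1; (ii) G' contains an edge uv with d_{G'}(u) + d_{G'}(v) ≤ 6; (iii) G' contains a 2-alternating cycle of length 4. Then the edge set of G can be partitioned into three pairwise disjoint sets inducing spanning subgraphs F₁, F₂, H such that F₁ and F₂ are forests with maximum degree at most max{2, ⌈Δ/2⌉} and H is a matching (i.e., H has maximum degree at most 1). -/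
/-- A 2-alternating cycle of length 4 in a subgraph `G'` of `G`: a 4-cycle
`v₀v₁v₂v₃v₀` (vertices pairwise distinct) with `d_{G'}(v₀) = d_{G'}(v₂) = 2`. -/
def SubgraphHasTwoAlternatingFourCycle {V : Type*} {G : SimpleGraph V}
    (G' : G.Subgraph) : Prop :=
  ∃ f : ℕ → V,
    (∀ i < 4, ∀ j < 4, f i = f j → i = j) ∧
    (∀ i < 4, G'.Adj (f i) (f ((i + 1) % 4))) ∧
    (G'.neighborSet (f 0)).ncard = 2 ∧ (G'.neighborSet (f 2)).ncard = 2

namespace SimpleGraph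

variable {V : Type*}

theorem neighborSet_sup_edge_of_ne {F : SimpleGraph V} {u v w : V} (hu : w ≠ u) (hv : w ≠ v) :
    (F ⊔ edge u v).neighborSet w = F.neighborSet w := by
  ext z
  simp only [mem_neighborSet, sup_adj, edge_adj]
  grind

theorem neighborSet_sup_edge_left {F : SimpleGraph V} {u v : V} (huv : u ≠ v) :
    (F ⊔ edge u v).neighborSet u = insert v (F.neighborSet u) := by
  ext z
  simp only [mem_neighborSet, sup_adj, edge_adj, Set.mem_insert_iff]
  grind

open Classical in
theorem ncard_neighborSet_sup_edge [Finite V] {F : SimpleGraph V} {u v : V} (huv : u ≠ v)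
    (h : ¬ F.Adj u v) (w : V) :
    ((F ⊔ edge u v).neighborSet w).ncard =
      (F.neighborSet w).ncard + if w = u ∨ w = v then 1 else 0 := by
  by_cases hu : w = u
  · subst hu
    rw [neighborSet_sup_edge_left huv, Set.ncard_insert_of_notMem (by simpa using h)]
    simp
  by_cases hv : w = v
  · subst hv
    rw [edge_comm, neighborSet_sup_edge_left huv.symm,
      Set.ncard_insert_of_notMem (by simpa using fun h' => h (h'.symm))]
    simp
  · simp [neighborSet_sup_edge_of_ne hu hv, hu, hv]

theorem IsAcyclic.sup_edge_of_ncard_eq_zero [Finite V] {F : SimpleGraph V} {u v : V}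
    (hF : F.IsAcyclic) (huv : u ≠ v) (hu : (F.neighborSet u).ncard = 0) :
    (F ⊔ edge u v).IsAcyclic := by
  have hnr : ¬ F.Reachable u v := by
    rintro ⟨p⟩
    cases p with
    | nil => exact huv rfl
    | cons h _ =>
      have := (Set.ncard_eq_zero (Set.toFinite _)).1 hu
      exact (Set.eq_empty_iff_forall_notMem.1 this _) h
  exact hF.sup_edge_of_not_reachable hnr

theorem ncard_edgeSet_lt_sup_edge [Finite V] {F : SimpleGraph V} {u v : V} (huv : u ≠ v)
    (h : ¬ F.Adj u v) : F.edgeSet.ncard < (F ⊔ edge u v).edgeSet.ncard := by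
  refine Set.ncard_lt_ncard (edgeSet_ssubset_edgeSet.2 (lt_of_le_of_ne le_sup_left ?_))
    (Set.toFinite _)
  intro h'
  exact h (h' ▸ (by simp [edge_adj, huv]))

theorem Adj.exists_eq_sup_edge {K : SimpleGraph V} {u v : V} (h : K.Adj u v) :
    ∃ K₀ : SimpleGraph V, ¬ K₀.Adj u v ∧ K = K₀ ⊔ edge u v := by
  refine ⟨K.deleteEdges {s(u, v)}, by simp, ?_⟩
  ext a b
  have := h.ne
  have := h.symm
  simp only [sup_adj, deleteEdges_adj, edge_adj, Set.mem_singleton_iff, Sym2.eq_iff]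
  grind

end SimpleGraph

section EdgePartition

open SimpleGraph

variable {V : Type*} {K F₁ F₂ H : SimpleGraph V} {u v : V}

theorem edgePartition3_iff : EdgePartition3 K F₁ F₂ H ↔
    F₁ ⊔ F₂ ⊔ H = K ∧ Disjoint F₁ F₂ ∧ Disjoint F₁ H ∧ Disjoint F₂ H := by
  simp only [EdgePartition3, disjoint_edgeSet, ← edgeSet_sup, edgeSet_inj]

theorem EdgePartition3.swap_left (h : EdgePartition3 K F₁ F₂ H) : EdgePartition3 K F₂ F₁ H :=
  ⟨by rw [Set.union_comm F₂.edgeSet]; exact h.1, h.2.1.symm, h.2.2.2, h.2.2.1⟩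

theorem EdgePartition3.rotate (h : EdgePartition3 K F₁ F₂ H) : EdgePartition3 K F₂ H F₁ :=
  ⟨by rw [← h.1]; ac_rfl, h.2.2.2, h.2.1.symm, h.2.2.1.symm⟩

theorem EdgePartition3.le_left (h : EdgePartition3 K F₁ F₂ H) : F₁ ≤ K := by
  rw [← (edgePartition3_iff.1 h).1, sup_assoc]
  exact le_sup_left

theorem EdgePartition3.sup_edge_left (h : EdgePartition3 K F₁ F₂ H) (hK : ¬ K.Adj u v) :
    EdgePartition3 (K ⊔ edge u v) (F₁ ⊔ edge u v) F₂ H := by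
  have disjoint_edge : ∀ {F : SimpleGraph V}, F ≤ K → Disjoint (edge u v) F := by
    intro F hF
    rw [← disjoint_edgeSet, Set.disjoint_left]
    rintro ⟨a, b⟩ h₁ h₂
    have h₂ : K.Adj a b := hF h₂
    have h₁ : (edge u v).Adj a b := h₁
    rw [edge_adj] at h₁
    have := h₂.symm
    grind
  have hF₂ := h.rotate.le_left
  have hH := h.rotate.rotate.le_left
  rw [edgePartition3_iff] at h ⊢
  obtain ⟨h, h₁, h₂, h₃⟩ := h
  refine ⟨?_, disjoint_sup_left.2 ⟨h₁, disjoint_edge hF₂⟩,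
    disjoint_sup_left.2 ⟨h₂, disjoint_edge hH⟩, h₃⟩
  rw [← h]
  ac_rfl

theorem EdgePartition3.sup_edge_middle (h : EdgePartition3 K F₁ F₂ H) (hK : ¬ K.Adj u v) :
    EdgePartition3 (K ⊔ edge u v) F₁ (F₂ ⊔ edge u v) H :=
  (h.swap_left.sup_edge_left hK).swap_left

theorem EdgePartition3.sup_edge_right (h : EdgePartition3 K F₁ F₂ H) (hK : ¬ K.Adj u v) :
    EdgePartition3 (K ⊔ edge u v) F₁ F₂ (H ⊔ edge u v) :=
  (h.rotate.rotate.sup_edge_left hK).rotate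

theorem EdgePartition3.ncard_neighborSet [Finite V] (h : EdgePartition3 K F₁ F₂ H) (w : V) :
    (K.neighborSet w).ncard =
      (F₁.neighborSet w).ncard + (F₂.neighborSet w).ncard + (H.neighborSet w).ncard := by
  obtain ⟨rfl, h₁, h₂, h₃⟩ := edgePartition3_iff.1 h
  have key : ∀ {A B : SimpleGraph V}, Disjoint A B →
      Disjoint (A.neighborSet w) (B.neighborSet w) := by
    intro A B hAB
    rw [← disjoint_edgeSet, Set.disjoint_left] at hAB
    exact Set.disjoint_left.2 fun z hA hB => hAB (a := s(w, z)) hA hB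
  have e : (F₁ ⊔ F₂ ⊔ H).neighborSet w = F₁.neighborSet w ∪ F₂.neighborSet w ∪ H.neighborSet w := by
    ext z
    simp
  rw [e, Set.ncard_union_eq (Set.disjoint_union_left.2 ⟨key h₂, key h₃⟩),
    Set.ncard_union_eq (key h₁)]

/-- An edge partition into two forests and a matching in which the degree of every vertex in
either forest is at most about half its degree in the whole graph. -/
def HasBalancedForestPartition (K : SimpleGraph V) : Prop :=
  ∃ F₁ F₂ H : SimpleGraph V, EdgePartition3 K F₁ F₂ H ∧ F₁.IsAcyclic ∧ F₂.IsAcyclic ∧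
    (∀ w, (F₁.neighborSet w).ncard ≤ max 2 (((K.neighborSet w).ncard + 1) / 2)) ∧
    (∀ w, (F₂.neighborSet w).ncard ≤ max 2 (((K.neighborSet w).ncard + 1) / 2)) ∧
    (∀ w, (H.neighborSet w).ncard ≤ 1)

theorem EdgePartition3.hasBalancedForestPartition_sup_edge [Finite V]
    (h : EdgePartition3 K F₁ F₂ H) (huv : u ≠ v) (hK : ¬ K.Adj u v)
    (hF₁ : F₁.IsAcyclic) (hF₂ : F₂.IsAcyclic)
    (d₁ : ∀ w, (F₁.neighborSet w).ncard ≤ max 2 (((K.neighborSet w).ncard + 1) / 2))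
    (d₂ : ∀ w, (F₂.neighborSet w).ncard ≤ max 2 (((K.neighborSet w).ncard + 1) / 2))
    (dH : ∀ w, (H.neighborSet w).ncard ≤ 1) (hu : (F₁.neighborSet u).ncard = 0)
    (hv : (F₁.neighborSet v).ncard + 1 ≤ max 2 (((K.neighborSet v).ncard + 2) / 2)) :
    HasBalancedForestPartition (K ⊔ edge u v) := by
  classical
  refine ⟨_, _, _, h.sup_edge_left hK, hF₁.sup_edge_of_ncard_eq_zero huv hu, hF₂,
    fun w => ?_, fun w => ?_, dH⟩
  · have := d₁ w
    rw [ncard_neighborSet_sup_edge huv hK,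
      ncard_neighborSet_sup_edge huv fun h' => hK (h.le_left h')]
    split_ifs with hw
    · rcases hw with rfl | rfl <;> omega
    · omega
  · have := d₂ w
    rw [ncard_neighborSet_sup_edge huv hK]
    omega

theorem HasBalancedForestPartition.sup_pendant_edge [Finite V]
    (hP : HasBalancedForestPartition K) (huv : u ≠ v) (hK : ¬ K.Adj u v)
    (hu : (K.neighborSet u).ncard = 0) : HasBalancedForestPartition (K ⊔ edge u v) := by
  obtain ⟨F₁, F₂, H, h, hF₁, hF₂, d₁, d₂, dH⟩ := hP
  have eu := h.ncard_neighborSet u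
  have ev := h.ncard_neighborSet v
  by_cases hv : (F₁.neighborSet v).ncard + 1 ≤ max 2 (((K.neighborSet v).ncard + 2) / 2)
  · exact h.hasBalancedForestPartition_sup_edge huv hK hF₁ hF₂ d₁ d₂ dH (by omega) hv
  · exact h.swap_left.hasBalancedForestPartition_sup_edge huv hK hF₂ hF₁ d₂ d₁ dH (by omega)
      (by omega)

theorem HasBalancedForestPartition.sup_light_edge [Finite V]
    (hP : HasBalancedForestPartition K) (huv : u ≠ v) (hK : ¬ K.Adj u v)
    (hd : (K.neighborSet u).ncard + (K.neighborSet v).ncard ≤ 4) :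
    HasBalancedForestPartition (K ⊔ edge u v) := by
  classical
  obtain ⟨F₁, F₂, H, h, hF₁, hF₂, d₁, d₂, dH⟩ := hP
  have eu := h.ncard_neighborSet u
  have ev := h.ncard_neighborSet v
  by_cases hH : (H.neighborSet u).ncard = 0 ∧ (H.neighborSet v).ncard = 0
  · refine ⟨_, _, _, h.sup_edge_right hK, hF₁, hF₂, fun w => ?_, fun w => ?_, fun w => ?_⟩
    · have := d₁ w
      rw [ncard_neighborSet_sup_edge huv hK]
      omega
    · have := d₂ w
      rw [ncard_neighborSet_sup_edge huv hK]
      omega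
    · have := dH w
      rw [ncard_neighborSet_sup_edge huv fun h' => hK (h.rotate.rotate.le_left h')]
      split_ifs with hw
      · rcases hw with rfl | rfl <;> omega
      · omega
  have hK' : ¬ K.Adj v u := fun h' => hK (h'.symm)
  have : ((F₁.neighborSet u).ncard = 0 ∧ (F₁.neighborSet v).ncard ≤ 1) ∨
      ((F₁.neighborSet v).ncard = 0 ∧ (F₁.neighborSet u).ncard ≤ 1) ∨
      ((F₂.neighborSet u).ncard = 0 ∧ (F₂.neighborSet v).ncard ≤ 1) ∨
      ((F₂.neighborSet v).ncard = 0 ∧ (F₂.neighborSet u).ncard ≤ 1) := by omega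
  rcases this with ⟨h₀, h₁⟩ | ⟨h₀, h₁⟩ | ⟨h₀, h₁⟩ | ⟨h₀, h₁⟩
  · exact h.hasBalancedForestPartition_sup_edge huv hK hF₁ hF₂ d₁ d₂ dH h₀ (by omega)
  · rw [edge_comm]
    exact h.hasBalancedForestPartition_sup_edge huv.symm hK' hF₁ hF₂ d₁ d₂ dH h₀ (by omega)
  · exact h.swap_left.hasBalancedForestPartition_sup_edge huv hK hF₂ hF₁ d₂ d₁ dH h₀ (by omega)
  · rw [edge_comm]
    exact h.swap_left.hasBalancedForestPartition_sup_edge huv.symm hK' hF₂ hF₁ d₂ d₁ dH h₀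
      (by omega)

theorem HasBalancedForestPartition.sup_four_cycle [Finite V] {x y a b : V}
    (hP : HasBalancedForestPartition K) (hxy : x ≠ y) (hab : a ≠ b) (hxa : x ≠ a) (hxb : x ≠ b)
    (hya : y ≠ a) (hyb : y ≠ b) (hx : (K.neighborSet x).ncard = 0)
    (hy : (K.neighborSet y).ncard = 0) (ha : 3 ≤ (K.neighborSet a).ncard)
    (hb : 3 ≤ (K.neighborSet b).ncard) :
    HasBalancedForestPartition (K ⊔ edge x a ⊔ edge x b ⊔ edge y a ⊔ edge y b) := by
  classical
  obtain ⟨F₁, F₂, H, h, hF₁, hF₂, d₁, d₂, dH⟩ := hP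
  have ex := h.ncard_neighborSet x
  have ey := h.ncard_neighborSet y
  have not_adj : ∀ {z w : V}, (K.neighborSet z).ncard = 0 → ¬ K.Adj z w := by
    intro z w hz hzw
    have := (Set.ncard_eq_zero (Set.toFinite _)).1 hz
    exact (Set.eq_empty_iff_forall_notMem.1 this _) hzw
  have n₁ : ¬ K.Adj x a := not_adj hx
  have n₂ : ¬ (K ⊔ edge x a).Adj x b := by
    have := not_adj (w := b) hx
    simp only [sup_adj, edge_adj]
    grind
  have n₃ : ¬ (K ⊔ edge x a ⊔ edge x b).Adj y a := by
    have := not_adj (w := a) hy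
    simp only [sup_adj, edge_adj]
    grind
  have n₄ : ¬ (K ⊔ edge x a ⊔ edge x b ⊔ edge y a).Adj y b := by
    have := not_adj (w := b) hy
    simp only [sup_adj, edge_adj]
    grind
  have p₁ := h.sup_edge_left n₁
  have p₂ := p₁.sup_edge_middle n₂
  have p₃ := p₂.sup_edge_middle n₃
  have p₄ := p₃.sup_edge_left n₄
  have e₁ := ncard_neighborSet_sup_edge hxa (F := F₁) fun h' => n₁ (h.le_left h')
  have e₂ := ncard_neighborSet_sup_edge hyb fun h' => n₄ (p₃.le_left h')
  have e₃ := ncard_neighborSet_sup_edge hxb fun h' => n₂ (p₁.swap_left.le_left h')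
  have e₄ := ncard_neighborSet_sup_edge hya fun h' => n₃ (p₂.swap_left.le_left h')
  have k₁ := ncard_neighborSet_sup_edge hxa n₁
  have k₂ := ncard_neighborSet_sup_edge hxb n₂
  have k₃ := ncard_neighborSet_sup_edge hya n₃
  have k₄ := ncard_neighborSet_sup_edge hyb n₄
  refine ⟨_, _, _, p₄, ?_, ?_, fun w => ?_, fun w => ?_, dH⟩
  · refine (hF₁.sup_edge_of_ncard_eq_zero hxa (by omega)).sup_edge_of_ncard_eq_zero hyb ?_
    rw [e₁, if_neg (by grind)]
    omega
  · refine (hF₂.sup_edge_of_ncard_eq_zero hxb (by omega)).sup_edge_of_ncard_eq_zero hya ?_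
    rw [e₃, if_neg (by grind)]
    omega
  · have := d₁ w
    rw [e₂, e₁, k₄, k₃, k₂, k₁]
    grind
  · have := d₂ w
    rw [e₄, e₃, k₄, k₃, k₂, k₁]
    grind

theorem HasBalancedForestPartition.of_reducible [Finite V] {G : SimpleGraph V}
    (hG : ∀ K ≤ G, K ≠ ⊥ →
      (∃ u v, K.Adj u v ∧ (K.neighborSet u).ncard ≤ 1) ∨
      (∃ u v, K.Adj u v ∧ (K.neighborSet u).ncard + (K.neighborSet v).ncard ≤ 6) ∨
      (∃ x a y b, x ≠ y ∧ a ≠ b ∧ K.Adj x a ∧ K.Adj x b ∧ K.Adj y a ∧ K.Adj y b ∧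
        (K.neighborSet x).ncard = 2 ∧ (K.neighborSet y).ncard = 2)) :
    HasBalancedForestPartition G := by
  classical
  suffices ∀ n, ∀ K ≤ G, K.edgeSet.ncard = n → HasBalancedForestPartition K from
    this _ G le_rfl rfl
  intro n
  induction n using Nat.strong_induction_on with
  | _ n ih =>
  rintro K hK rfl
  by_cases hbot : K = ⊥
  · subst hbot
    exact ⟨⊥, ⊥, ⊥, by simp [edgePartition3_iff], isAcyclic_bot, isAcyclic_bot,
      by simp [neighborSet], by simp [neighborSet], by simp [neighborSet]⟩
  by_cases hlight : ∃ u v, K.Adj u v ∧ (K.neighborSet u).ncard + (K.neighborSet v).ncard ≤ 6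
  · obtain ⟨u, v, huv, hd⟩ := hlight
    obtain ⟨K₀, hn, rfl⟩ := huv.exists_eq_sup_edge
    have hP := ih _ (ncard_edgeSet_lt_sup_edge huv.ne hn) K₀ (le_sup_left.trans hK) rfl
    refine hP.sup_light_edge huv.ne hn ?_
    simp only [ncard_neighborSet_sup_edge huv.ne hn, true_or, or_true, if_true] at hd
    omega
  rcases hG K hK hbot with ⟨u, v, huv, hd⟩ | h | ⟨x, a, y, b, hxy, hab, hxa, hxb, hya, hyb, hx, hy⟩
  · obtain ⟨K₀, hn, rfl⟩ := huv.exists_eq_sup_edge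
    have hP := ih _ (ncard_edgeSet_lt_sup_edge huv.ne hn) K₀ (le_sup_left.trans hK) rfl
    refine hP.sup_pendant_edge huv.ne hn ?_
    simp only [ncard_neighborSet_sup_edge huv.ne hn, true_or, if_true] at hd
    omega
  · exact absurd h hlight
  · have ha : 5 ≤ (K.neighborSet a).ncard := by
      by_contra h'
      exact hlight ⟨x, a, hxa, by omega⟩
    have hb : 5 ≤ (K.neighborSet b).ncard := by
      by_contra h'
      exact hlight ⟨x, b, hxb, by omega⟩
    have hxa' := hxa.ne
    have hxb' := hxb.ne
    have hya' := hya.ne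
    have hyb' := hyb.ne
    obtain ⟨K₃, n₃, rfl⟩ := hyb.exists_eq_sup_edge
    replace hya : K₃.Adj y a := by simp only [sup_adj, edge_adj] at hya; grind
    replace hxb : K₃.Adj x b := by simp only [sup_adj, edge_adj] at hxb; grind
    replace hxa : K₃.Adj x a := by simp only [sup_adj, edge_adj] at hxa; grind
    obtain ⟨K₂, n₂, rfl⟩ := hya.exists_eq_sup_edge
    replace hxb : K₂.Adj x b := by simp only [sup_adj, edge_adj] at hxb; grind
    replace hxa : K₂.Adj x a := by simp only [sup_adj, edge_adj] at hxa; grind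
    obtain ⟨K₁, n₁, rfl⟩ := hxb.exists_eq_sup_edge
    replace hxa : K₁.Adj x a := by simp only [sup_adj, edge_adj] at hxa; grind
    obtain ⟨K₀, n₀, rfl⟩ := hxa.exists_eq_sup_edge
    have l₀ := ncard_edgeSet_lt_sup_edge hxa' n₀
    have l₁ := ncard_edgeSet_lt_sup_edge hxb' n₁
    have l₂ := ncard_edgeSet_lt_sup_edge hya' n₂
    have l₃ := ncard_edgeSet_lt_sup_edge hyb' n₃
    have hP := ih _ (l₀.trans (l₁.trans (l₂.trans l₃))) K₀
      (le_sup_left.trans <| le_sup_left.trans <| le_sup_left.trans <| le_sup_left.trans hK) rfl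
    rw [ncard_neighborSet_sup_edge hyb' n₃, ncard_neighborSet_sup_edge hya' n₂,
      ncard_neighborSet_sup_edge hxb' n₁, ncard_neighborSet_sup_edge hxa' n₀] at hx hy ha hb
    refine hP.sup_four_cycle hxy hab hxa' hxb' hya' hyb' ?_ ?_ ?_ ?_ <;> grind

end EdgePartition

/-- Let `G` be a finite simple graph with maximum degree `Δ` such that
every (nonempty) subgraph `G'` of `G` has a vertex of degree at most 1, or contains an
edge `uv` with `d_{G'}(u) + d_{G'}(v) ≤ 6`, or contains a 2-alternating cycle of
length 4. Then `E(G)` can be partitioned into two forests `F₁`, `F₂` and a subgraph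
`H` with `Δ(Fᵢ) ≤ max {2, ⌈Δ/2⌉}` and `H` a matching (`Δ(H) ≤ 1`). -/
theorem statement4 {V : Type*} [Fintype V] (G : SimpleGraph V)
    [DecidableRel G.Adj] (Δ : ℕ) (hΔ : Δ = G.maxDegree)
    (hG : ∀ G' : G.Subgraph, G'.verts.Nonempty →
      (∃ v ∈ G'.verts, (G'.neighborSet v).ncard ≤ 1) ∨
      (∃ u v, G'.Adj u v ∧ (G'.neighborSet u).ncard + (G'.neighborSet v).ncard ≤ 6) ∨
      SubgraphHasTwoAlternatingFourCycle G') :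
    ∃ F₁ F₂ H : SimpleGraph V,
      EdgePartition3 G F₁ F₂ H ∧
      F₁.IsAcyclic ∧ F₂.IsAcyclic ∧
      (∀ v, ((F₁.neighborSet v).ncard : ℤ) ≤ max 2 ⌈(Δ : ℚ) / 2⌉) ∧
      (∀ v, ((F₂.neighborSet v).ncard : ℤ) ≤ max 2 ⌈(Δ : ℚ) / 2⌉) ∧
      (∀ v, (H.neighborSet v).ncard ≤ 1) := by
  classical
  obtain ⟨F₁, F₂, H, h, hF₁, hF₂, d₁, d₂, dH⟩ : HasBalancedForestPartition G := by
    refine .of_reducible fun K hK hbot => ?_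
    let G' : G.Subgraph :=
      { verts := K.support
        Adj := K.Adj
        adj_sub := fun h => hK h
        edge_vert := fun h => ⟨_, h⟩
        symm := K.symm }
    have hne : G'.verts.Nonempty := by
      obtain ⟨u, v, huv⟩ := SimpleGraph.ne_bot_iff_exists_adj.1 hbot
      exact ⟨u, v, huv⟩
    rcases hG G' hne with ⟨v, ⟨w, hw⟩, hv⟩ | h | ⟨f, hinj, hadj, h₀, h₂⟩
    · exact Or.inl ⟨v, w, hw, hv⟩
    · exact Or.inr (Or.inl h)
    · refine Or.inr (Or.inr ⟨f 0, f 1, f 2, f 3, fun h => ?_, fun h => ?_, hadj 0 (by simp),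
        (hadj 3 (by simp)).symm, (hadj 1 (by simp)).symm, hadj 2 (by simp), h₀, h₂⟩)
      · simpa using hinj 0 (by simp) 2 (by simp) h
      · simpa using hinj 1 (by simp) 3 (by simp) h
  have bound : ∀ n v, n ≤ max 2 (((G.neighborSet v).ncard + 1) / 2) →
      (n : ℤ) ≤ max 2 ⌈(Δ : ℚ) / 2⌉ := by
    intro n v hn
    have hd : (G.neighborSet v).ncard ≤ Δ := by
      rw [hΔ, Set.ncard_eq_toFinset_card', ← SimpleGraph.neighborFinset_def]
      exact G.degree_le_maxDegree v
    have hc : (Δ : ℤ) ≤ 2 * ⌈(Δ : ℚ) / 2⌉ := by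
      have := Int.le_ceil ((Δ : ℚ) / 2)
      have h' : (Δ : ℚ) ≤ 2 * (⌈(Δ : ℚ) / 2⌉ : ℤ) := by linarith
      exact_mod_cast h'
    omega
  exact ⟨F₁, F₂, H, h, hF₁, hF₂, fun v => bound _ v (d₁ v), fun v => bound _ v (d₂ v), dH⟩
end
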